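/- arXiv:2512.14381 — 2 statements merged into one kernel-verified Lean document; each statement's English description precedes it below -/
import Mathlib

section
/- Let m ≥ 11. For every partition λ of 2m there exist partitions α, β of m, neither of which equals (m−1,1) or (2,1^{m−2}), such that the Littlewood–Richardson coefficient c^λ_{αβ} is positive. -/
/-- A Littlewood–Richardson skew tableau of shape `lam / alp` and content `bet`:
a filling of the cells of `lam` outside `alp` (values in `ℕ`, the value `v`
representing the letter `v+1`) whose rows weakly increase, whose columns strictly
increase, which contains exactly `bet_{v+1}` cells with value `v`, and whose reverse
reading word (rows read right-to-left, top to bottom) is a lattice word. -/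
structure LRSkewTableau (lam alp bet : YoungDiagram) where
  entry : ℕ → ℕ → ℕ
  zero_out : ∀ i j : ℕ, (i, j) ∉ lam.cells \ alp.cells → entry i j = 0
  row_weak : ∀ i j1 j2 : ℕ, j1 ≤ j2 → (i, j1) ∈ lam.cells \ alp.cells →
      (i, j2) ∈ lam.cells \ alp.cells → entry i j1 ≤ entry i j2
  col_strict : ∀ i1 i2 j : ℕ, i1 < i2 → (i1, j) ∈ lam.cells \ alp.cells →
      (i2, j) ∈ lam.cells \ alp.cells → entry i1 j < entry i2 j
  content : ∀ v : ℕ,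
      ((lam.cells \ alp.cells).filter (fun c => entry c.1 c.2 = v)).card = bet.rowLen v
  lattice : ∀ i j v : ℕ, (i, j) ∈ lam.cells \ alp.cells →
      ((lam.cells \ alp.cells).filter
          (fun c => (c.1 < i ∨ (c.1 = i ∧ j ≤ c.2)) ∧ entry c.1 c.2 = v + 1)).card ≤
        ((lam.cells \ alp.cells).filter
          (fun c => (c.1 < i ∨ (c.1 = i ∧ j ≤ c.2)) ∧ entry c.1 c.2 = v)).card

/-- The Littlewood–Richardson coefficient `c^lam_{alp bet}`, the multiplicity of the Schur
function `s_lam` in the product `s_alp · s_bet`, given by the Littlewood–Richardson rule as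
the number of LR skew tableaux of shape `lam / alp` and content `bet`. -/
noncomputable def lrCoeff (alp bet lam : YoungDiagram) : ℕ :=
  Nat.card (LRSkewTableau lam alp bet)


open Finset

namespace LRAux

/-- Young diagram with prescribed column lengths. -/
def ofCol (f : ℕ → ℕ) (N : ℕ) (hf : Antitone f) : YoungDiagram where
  cells := ((Finset.range (f 0)) ×ˢ (Finset.range N)).filter (fun p => p.1 < f p.2)
  isLowerSet := by
    rintro ⟨i, j⟩ ⟨i', j'⟩ h hm
    simp only [coe_filter, mem_product, Finset.mem_range, Set.mem_ofPred_eq] at hm ⊢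
    obtain ⟨h1, h2⟩ := (Prod.mk_le_mk.mp h)
    have := hf h2
    have := hf (Nat.zero_le j')
    omega

theorem mem_ofCol {f : ℕ → ℕ} {N : ℕ} (hf : Antitone f) (hN : f N = 0) (i j : ℕ) :
    (i, j) ∈ ofCol f N hf ↔ i < f j := by
  rw [← YoungDiagram.mem_cells]
  simp only [ofCol, mem_filter, mem_product, Finset.mem_range]
  have h0 := hf (Nat.zero_le j)
  constructor
  · exact fun h => h.2
  · intro h
    refine ⟨⟨by omega, ?_⟩, h⟩
    by_contra hc
    have := hf (not_lt.mp hc)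
    omega

theorem colLen_ofCol {f : ℕ → ℕ} {N : ℕ} (hf : Antitone f) (hN : f N = 0) (j : ℕ) :
    (ofCol f N hf).colLen j = f j := by
  apply le_antisymm
  · by_contra hc
    have := (YoungDiagram.mem_iff_lt_colLen).mpr (not_le.mp hc)
    rw [mem_ofCol hf hN] at this
    omega
  · by_contra hc
    have := (mem_ofCol hf hN _ _).mpr (not_le.mp hc)
    rw [YoungDiagram.mem_iff_lt_colLen] at this
    omega

theorem card_eq_sum (l : YoungDiagram) (N : ℕ) (hN : l.colLen N = 0) :
    l.card = ∑ j ∈ range N, l.colLen j := by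
  have : l.cells.card = ∑ j ∈ range N, (l.cells.filter (fun c => c.2 = j)).card := by
    apply Finset.card_eq_sum_card_fiberwise
    rintro ⟨i, j⟩ h
    simp only [coe_range, Set.mem_Iio]
    by_contra hc
    have h1 : (i, j) ∈ l := by simpa using h
    rw [YoungDiagram.mem_iff_lt_colLen] at h1
    have := l.colLen_anti _ _ (not_lt.mp hc)
    omega
  rw [YoungDiagram.card, this]
  refine Finset.sum_congr rfl fun j _ => ?_
  rw [YoungDiagram.colLen_eq_card]
  rfl

theorem lr_finite (lam alp bet : YoungDiagram) : Finite (LRSkewTableau lam alp bet) := by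
  have key : ∀ (T : LRSkewTableau lam alp bet) (i j : ℕ), T.entry i j < bet.colLen 0 + 1 := by
    intro T i j
    by_cases h : (i, j) ∈ lam.cells \ alp.cells
    · have h1 := T.content (T.entry i j)
      have h2 : 0 < bet.rowLen (T.entry i j) := by
        rw [← h1, Finset.card_pos]
        exact ⟨(i, j), by simp only [mem_filter]; exact ⟨h, trivial⟩⟩
      have h3 := YoungDiagram.mem_iff_lt_rowLen.mpr h2
      have := YoungDiagram.mem_iff_lt_colLen.mp h3
      omega
    · rw [T.zero_out i j h]; omega
  apply Finite.of_injective
    (β := (lam.cells → Fin (bet.colLen 0 + 1)))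
    (fun T c => ⟨T.entry c.1.1 c.1.2, key T _ _⟩)
  intro T S hTS
  have : T.entry = S.entry := by
    funext i j
    by_cases h : (i, j) ∈ lam.cells
    · have := congrFun hTS ⟨(i, j), h⟩
      simpa using this
    · have h' : (i, j) ∉ lam.cells \ alp.cells := fun hh => h (Finset.mem_sdiff.mp hh).1
      rw [T.zero_out _ _ h', S.zero_out _ _ h']
  cases T; cases S; simp only at this; subst this; rfl

theorem lr_pos {lam alp bet : YoungDiagram} (T : LRSkewTableau lam alp bet) :
    0 < lrCoeff alp bet lam := by
  have := lr_finite lam alp bet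
  have : Nonempty (LRSkewTableau lam alp bet) := ⟨T⟩
  exact Nat.card_pos

theorem mem_skew {lam alp : YoungDiagram} {i j : ℕ} :
    (i, j) ∈ lam.cells \ alp.cells ↔ alp.colLen j ≤ i ∧ i < lam.colLen j := by
  rw [Finset.mem_sdiff, YoungDiagram.mem_cells, YoungDiagram.mem_cells,
    YoungDiagram.mem_iff_lt_colLen, YoungDiagram.mem_iff_lt_colLen]
  omega

/-- The column filling. -/
theorem colFilling (lam alp bet : YoungDiagram) (N : ℕ) (hN : lam.colLen N = 0)
    (hb : ∀ v, bet.rowLen v =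
      ((range N).filter (fun j => v < lam.colLen j - alp.colLen j)).card) :
    Nonempty (LRSkewTableau lam alp bet) := by
  classical
  refine ⟨⟨fun i j => if (i, j) ∈ lam.cells \ alp.cells then i - alp.colLen j else 0,
    ?_, ?_, ?_, ?_, ?_⟩⟩
  · intro i j h; simp only [if_neg h]
  · intro i j1 j2 h h1 h2
    simp only [if_pos h1, if_pos h2]
    have := alp.colLen_anti _ _ h
    omega
  · intro i1 i2 j h h1 h2
    simp only [if_pos h1, if_pos h2]
    rw [mem_skew] at h1 h2
    omega
  · intro v
    rw [hb]
    symm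
    refine Finset.card_bij (fun j _ => (alp.colLen j + v, j)) ?_ ?_ ?_
    · intro j hj
      simp only [mem_filter, Finset.mem_range] at hj
      have : (alp.colLen j + v, j) ∈ lam.cells \ alp.cells := by rw [mem_skew]; omega
      simp only [mem_filter, if_pos this]
      exact ⟨this, by omega⟩
    · intro a _ b _ h
      exact (Prod.mk.inj h).2
    · rintro ⟨i, j⟩ h
      simp only [mem_filter] at h
      obtain ⟨h1, h2⟩ := h
      rw [if_pos h1] at h2
      rw [mem_skew] at h1
      refine ⟨j, ?_, ?_⟩
      · simp only [mem_filter, Finset.mem_range]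
        refine ⟨?_, by omega⟩
        by_contra hc
        have := lam.colLen_anti _ _ (not_lt.mp hc)
        omega
      · rw [Prod.mk.injEq]; exact ⟨by omega, rfl⟩
  · intro i j v h
    refine Finset.card_le_card_of_injOn (fun c => (c.1 - 1, c.2)) ?_ ?_
    · rintro ⟨a, b⟩ hab
      simp only [coe_filter, Set.mem_ofPred_eq] at hab ⊢
      obtain ⟨h1, h2, h3⟩ := hab
      rw [if_pos h1] at h3
      rw [mem_skew] at h1
      have h4 : (a - 1, b) ∈ lam.cells \ alp.cells := by rw [mem_skew]; omega
      rw [if_pos h4]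
      refine ⟨h4, ?_, ?_⟩ <;> omega
    · rintro ⟨a, b⟩ hab ⟨a', b'⟩ hab' he
      simp only [coe_filter, Set.mem_ofPred_eq] at hab hab'
      obtain ⟨h1, h2, h3⟩ := hab
      obtain ⟨h1', h2', h3'⟩ := hab'
      rw [if_pos h1] at h3
      rw [if_pos h1'] at h3'
      simp only [Prod.mk.injEq] at he ⊢
      omega

theorem rowLen_of_rowLens (l : YoungDiagram) (L : List ℕ) (h : l.rowLens = L) (i : ℕ) :
    l.rowLen i = L.getD i 0 := by
  subst h
  by_cases hi : i < l.rowLens.length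
  · rw [List.getD_eq_getElem _ _ hi, YoungDiagram.get_rowLens]
  · rw [List.getD_eq_default _ _ (not_lt.mp hi)]
    rw [YoungDiagram.length_rowLens] at hi
    by_contra hc
    have : (i, 0) ∈ l := YoungDiagram.mem_iff_lt_rowLen.mpr (by omega)
    rw [YoungDiagram.mem_iff_lt_colLen] at this
    omega

theorem lt_iff (l : YoungDiagram) (i j : ℕ) : i < l.colLen j ↔ j < l.rowLen i := by
  rw [← YoungDiagram.mem_iff_lt_colLen, YoungDiagram.mem_iff_lt_rowLen]

theorem rep_getD (n i : ℕ) : (List.replicate n 1).getD i 0 = if i < n then 1 else 0 := by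
  split_ifs with h
  · rw [List.getD_eq_getElem _ _ (by simpa using h)]; simp
  · rw [List.getD_eq_default _ _ (by simpa using h)]

theorem bad1 (l : YoungDiagram) (m : ℕ) (h : l.rowLens = [m - 1, 1]) :
    l.rowLen 0 = m - 1 ∧ l.rowLen 1 = 1 ∧ l.rowLen 2 = 0 := by
  have := rowLen_of_rowLens l _ h
  refine ⟨?_, ?_, ?_⟩ <;> rw [this] <;> rfl

theorem bad2 (l : YoungDiagram) (m : ℕ) (hm : 11 ≤ m) (h : l.rowLens = 2 :: List.replicate (m - 2) 1) :
    l.rowLen 0 = 2 ∧ l.rowLen 1 = 1 ∧ l.rowLen (m - 2) = 1 ∧ l.rowLen (m - 1) = 0 := by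
  have := rowLen_of_rowLens l _ h
  obtain ⟨k, rfl⟩ : ∃ k, m = k + 3 := ⟨m - 3, by omega⟩
  refine ⟨?_, ?_, ?_, ?_⟩ <;> rw [this]
  · rfl
  · rw [List.getD_cons_succ, rep_getD, if_pos (by omega)]
  · rw [show k + 3 - 2 = k + 1 by omega, List.getD_cons_succ, rep_getD, if_pos (by omega)]
  · rw [show k + 3 - 1 = k + 1 + 1 by omega, List.getD_cons_succ, rep_getD, if_neg (by omega)]

/-- The multiset of column lengths `d` is `{e, ≤ 1, ≤ 1, …}`. -/
def Bad (d : ℕ → ℕ) (e : ℕ) : Prop := ∃ j0, d j0 = e ∧ ∀ j, j ≠ j0 → d j ≤ 1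

theorem sum_ind (N r : ℕ) (h : r ≤ N) : ∑ j ∈ range N, (if j < r then 1 else 0) = r := by
  rw [Finset.sum_boole]
  have : (range N).filter (fun j => j < r) = range r := by
    ext x; simp only [mem_filter, Finset.mem_range]; omega
  rw [this]; simp

theorem reduce (m : ℕ) (hm : 11 ≤ m) (lam : YoungDiagram) (hcard : lam.card = 2 * m)
    (N : ℕ) (hN : lam.colLen N = 0) (a : ℕ → ℕ) (ha : Antitone a) (hle : ∀ j, a j ≤ lam.colLen j)
    (hs : ∑ j ∈ range N, a j = m)
    (g1 : ¬ (a 0 = 2 ∧ a 1 = 1 ∧ a (m - 2) = 1)) (g2 : ¬ (a 0 = m - 1 ∧ a 1 = 1 ∧ a 2 = 0))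
    (b1 : ¬ Bad (fun j => lam.colLen j - a j) 2)
    (b2 : ¬ Bad (fun j => lam.colLen j - a j) (m - 1)) :
    ∃ alp bet : YoungDiagram, alp.card = m ∧ bet.card = m ∧
      alp.rowLens ≠ [m - 1, 1] ∧ alp.rowLens ≠ 2 :: List.replicate (m - 2) 1 ∧
      bet.rowLens ≠ [m - 1, 1] ∧ bet.rowLens ≠ 2 :: List.replicate (m - 2) 1 ∧
      0 < lrCoeff alp bet lam := by
  have haN : a N = 0 := by have := hle N; omega
  set d : ℕ → ℕ := fun j => lam.colLen j - a j with hd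
  set g : ℕ → ℕ := fun v => ((range N).filter (fun j => v < d j)).card with hg
  have hgA : Antitone g := by
    intro v w h
    apply Finset.card_le_card
    intro j hj
    simp only [mem_filter] at hj ⊢
    exact ⟨hj.1, by omega⟩
  set M := lam.colLen 0
  have hdM : ∀ j, d j ≤ M := fun j => by
    have := lam.colLen_anti _ _ (Nat.zero_le j)
    simp only [hd]; omega
  have hdN : ∀ j, N ≤ j → d j = 0 := fun j hj => by
    have := lam.colLen_anti _ _ hj
    simp only [hd]; omega
  have hgM : g M = 0 := by
    simp only [hg, Finset.card_eq_zero, Finset.filter_eq_empty_iff]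
    intro j _
    have := hdM j
    omega
  have hdsum : ∑ j ∈ range N, d j = m := by
    have h1 := card_eq_sum lam N hN
    have h2 : ∑ j ∈ range N, (d j + a j) = ∑ j ∈ range N, lam.colLen j := by
      refine Finset.sum_congr rfl fun j _ => ?_
      have := hle j
      simp only [hd]; omega
    rw [Finset.sum_add_distrib] at h2
    omega
  have hgsum : ∑ v ∈ range M, g v = m := by
    rw [← hdsum]
    simp only [hg, Finset.card_filter]
    rw [Finset.sum_comm]
    exact Finset.sum_congr rfl fun j _ => sum_ind _ _ (hdM j)
  set alp := ofCol a N ha with halp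
  have hac : ∀ j, alp.colLen j = a j := colLen_ofCol ha haN
  set bet := (ofCol g M hgA).transpose with hbet
  have hbr : ∀ v, bet.rowLen v = g v := by
    intro v
    rw [hbet, YoungDiagram.rowLen_transpose]
    exact colLen_ofCol hgA hgM v
  have aux : ∀ v, g v = 0 → ∀ j, d j ≤ v := by
    intro v h j
    simp only [hg, Finset.card_eq_zero, Finset.filter_eq_empty_iff] at h
    by_cases hj : j < N
    · have := h (Finset.mem_range.mpr hj); omega
    · have := hdN j (by omega); omega
  have aux1 : ∀ v, g v = 1 → ∃ j0, v < d j0 ∧ ∀ j, j ≠ j0 → d j ≤ v := by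
    intro v h
    simp only [hg, Finset.card_eq_one] at h
    obtain ⟨j0, h⟩ := h
    refine ⟨j0, ?_, ?_⟩
    · have : j0 ∈ (range N).filter (fun j => v < d j) := by rw [h]; simp
      exact (Finset.mem_filter.mp this).2
    · intro j hj
      by_contra hc
      have : j ∈ (range N).filter (fun j => v < d j) := by
        rw [Finset.mem_filter, Finset.mem_range]
        refine ⟨?_, by omega⟩
        by_contra hh
        have := hdN j (by omega)
        omega
      rw [h] at this
      exact hj (Finset.mem_singleton.mp this)
  refine ⟨alp, bet, ?_, ?_, ?_, ?_, ?_, ?_, ?_⟩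
  · rw [card_eq_sum alp N (by rw [hac, haN])]
    simp only [hac, hs]
  · have : bet.card = (ofCol g M hgA).card := by
      rw [hbet, YoungDiagram.transpose]; simp [YoungDiagram.card]
    rw [this, card_eq_sum _ M (by rw [colLen_ofCol hgA hgM, hgM])]
    simp only [colLen_ofCol hgA hgM, hgsum]
  · intro h
    obtain ⟨h0, h1, h2⟩ := bad1 _ _ h
    apply g1
    have q := lt_iff alp
    simp only [hac] at q
    have q1 := q 0 0
    have q2 := q 1 0
    have q3 := q 2 0
    have q4 := q 0 1
    have q5 := q 1 1
    have q6 := q 0 (m-2)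
    have q7 := q 1 (m-2)
    omega
  · intro h
    obtain ⟨h0, h1, h2, h3⟩ := bad2 _ _ hm h
    apply g2
    have q := lt_iff alp
    simp only [hac] at q
    have q1 := q 0 0
    have q2 := q (m-2) 0
    have q3 := q (m-1) 0
    have q4 := q 0 1
    have q5 := q 1 1
    have q6 := q 0 2
    omega
  · intro h
    obtain ⟨h0, h1, h2⟩ := bad1 _ _ h
    rw [hbr] at h0 h1 h2
    apply b1
    obtain ⟨j0, hj0, hj⟩ := aux1 1 h1
    have := aux 2 h2 j0
    exact ⟨j0, by omega, hj⟩
  · intro h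
    obtain ⟨h0, h1, h2, h3⟩ := bad2 _ _ hm h
    rw [hbr] at h0 h1 h2 h3
    apply b2
    obtain ⟨j0, hj0, hj⟩ := aux1 1 h1
    obtain ⟨j1, hj1, hj'⟩ := aux1 _ h2
    have := aux _ h3 j1
    have e : j1 = j0 := by
      by_contra hne
      have := hj j1 hne
      omega
    subst e
    exact ⟨j1, by omega, hj⟩
  · obtain ⟨T⟩ := colFilling lam alp bet N hN (fun v => by rw [hbr]; simp only [hg, hd, hac])
    exact lr_pos T

/-- Combination of indicator functions. -/
def cmb (x r y s z k : ℕ) (j : ℕ) : ℕ :=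
  (if j < r then x else 0) + (if j < s then y else 0) + (if j = k then z else 0)

theorem sum_cmb (N x r y s z k : ℕ) (hr : r ≤ N) (hs : s ≤ N) (hk : k < N) :
    ∑ j ∈ range N, cmb x r y s z k j = x * r + y * s + z := by
  have aux : ∀ x r, r ≤ N → ∑ j ∈ range N, (if j < r then x else 0) = x * r := by
    intro x r hr
    conv_rhs => rw [← sum_ind N r hr, Finset.mul_sum]
    refine Finset.sum_congr rfl fun j _ => ?_
    split_ifs <;> simp
  unfold cmb
  rw [Finset.sum_add_distrib, Finset.sum_add_distrib, aux x r hr, aux y s hs]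
  congr 1
  rw [Finset.sum_ite_eq' (range N) k (fun _ => z), if_pos (Finset.mem_range.mpr hk)]

theorem cmb_anti (x r y s k : ℕ) : Antitone (cmb x r y s 0 k) := by
  intro i j h
  unfold cmb
  split_ifs <;> omega

def Ok (m N : ℕ) (c a : ℕ → ℕ) : Prop :=
  Antitone a ∧ (∀ j, a j ≤ c j) ∧ ∑ j ∈ range N, a j = m ∧
    ¬ (a 0 = 2 ∧ a 1 = 1 ∧ a (m - 2) = 1) ∧ ¬ (a 0 = m - 1 ∧ a 1 = 1 ∧ a 2 = 0) ∧
    ¬ Bad (fun j => c j - a j) 2 ∧ ¬ Bad (fun j => c j - a j) (m - 1)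

/-- Interpolation between antitone sequences. -/
theorem interp (N : ℕ) (c b : ℕ → ℕ) (hc : Antitone c) (hb : Antitone b) (hbc : ∀ j, b j ≤ c j)
    (hN : c N = 0) (t : ℕ) (ht : ∑ j ∈ range N, b j + t ≤ ∑ j ∈ range N, c j) :
    ∃ a : ℕ → ℕ, Antitone a ∧ (∀ j, b j ≤ a j) ∧ (∀ j, a j ≤ c j) ∧
      ∑ j ∈ range N, a j = ∑ j ∈ range N, b j + t := by
  induction t with
  | zero => exact ⟨b, hb, fun _ => le_rfl, hbc, rfl⟩
  | succ t ih =>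
    obtain ⟨a, h1, h2, h3, h4⟩ := ih (by omega)
    have hex : ∃ j, a j < c j := by
      by_contra hcon
      push Not at hcon
      have := Finset.sum_le_sum (s := range N) (fun j _ => hcon j)
      omega
    classical
    let k := Nat.find hex
    have hk : a k < c k := Nat.find_spec hex
    have hk' : ∀ j, j < k → c j ≤ a j := fun j hj => not_lt.mp (Nat.find_min hex hj)
    have hkN : k < N := by
      by_contra hh
      have : c k ≤ c N := hc (not_lt.mp hh)
      omega
    refine ⟨fun j => a j + if j = k then 1 else 0, ?_, ?_, ?_, ?_⟩
    · intro i j hij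
      have e1 := h1 hij
      have e2 := hk' i
      have e3 := hc hij
      by_cases hj : j = k
      · rw [hj] at e1 e3 hij ⊢
        by_cases hi : i = k
        · rw [hi]
        · have := e2 (by omega)
          simp only [if_true, if_neg hi]; omega
      · simp only [if_neg hj]; omega
    · intro j; exact le_trans (h2 j) (Nat.le_add_right _ _)
    · intro j
      have := h3 j
      by_cases hj : j = k
      · subst hj; simp only [if_true]; omega
      · simp only [if_neg hj]; omega
    · rw [Finset.sum_add_distrib, Finset.sum_ite_eq' (range N) k (fun _ => 1),
        if_pos (Finset.mem_range.mpr hkN)]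
      omega

theorem ub {N S : ℕ} {c : ℕ → ℕ} (hs : ∑ j ∈ range N, c j = S)
    (x r y s z k : ℕ) (hr : r ≤ N) (hs' : s ≤ N) (hk : k < N)
    (h : ∀ j, j < N → c j ≤ cmb x r y s z k j) : S ≤ x * r + y * s + z := by
  rw [← hs, ← sum_cmb N x r y s z k hr hs' hk]
  exact Finset.sum_le_sum fun j hj => h j (Finset.mem_range.mp hj)

theorem lb {N S : ℕ} {c : ℕ → ℕ} (hs : ∑ j ∈ range N, c j = S)
    (x r y s z k : ℕ) (hr : r ≤ N) (hs' : s ≤ N) (hk : k < N)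
    (h : ∀ j, j < N → cmb x r y s z k j ≤ c j) : x * r + y * s + z ≤ S := by
  rw [← hs, ← sum_cmb N x r y s z k hr hs' hk]
  exact Finset.sum_le_sum fun j hj => h j (Finset.mem_range.mp hj)

set_option maxHeartbeats 4000000 in
theorem caseA (m N : ℕ) (hm : 11 ≤ m) (c : ℕ → ℕ) (hc : Antitone c)
    (hNm : 2 * m + 1 ≤ N) (hs : ∑ j ∈ range N, c j = 2 * m) (h : 1 ≤ c (m - 1)) : ∃ a, Ok m N c a := by
  by_cases hP : Bad (fun j => c j - cmb 1 m 0 0 0 0 j) 2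
  · obtain ⟨j0, h0, h1⟩ := hP
    simp only [cmb] at h0 h1
    have hj0 : j0 < m := by
      by_contra hcon
      have := lb hs 2 (m+1) 0 0 0 0 (by omega) (by omega) (by omega) (by
        intro j hj
        have := @hc j j0
        unfold cmb; split_ifs <;> omega)
      omega
    have hj00 : j0 = 0 := by
      by_contra hcon
      have := h1 0 (by omega)
      have := hc (Nat.zero_le j0)
      grind
    subst hj00
    have hc0 : c 0 = 3 := by grind
    have hc1 : c 1 ≤ 2 := by have := h1 1 (by omega); grind
    by_cases hk : c (m - 2) ≤ 1
    · have hd : ∀ j, c j - cmb 1 (m-2) 2 1 0 0 j ≤ 1 := by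
        intro j
        have := @hc (m-2) j
        have := @hc 1 j
        by_cases hj : j = 0
        · subst hj; unfold cmb; split_ifs <;> omega
        · unfold cmb; split_ifs <;> omega
      refine ⟨cmb 1 (m-2) 2 1 0 0, cmb_anti _ _ _ _ _, ?_, ?_, ?_, ?_, ?_, ?_⟩
      · intro j
        by_cases hj : j = 0
        · subst hj; unfold cmb; split_ifs <;> omega
        have := @hc j (m-1)
        unfold cmb; split_ifs <;> omega
      · rw [sum_cmb] <;> omega
      · unfold cmb; split_ifs <;> omega
      · unfold cmb; split_ifs <;> omega
      · rintro ⟨j, hj, -⟩; have := hd j; simp only at hj; omega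
      · rintro ⟨j, hj, -⟩; have := hd j; simp only at hj; omega
    · refine ⟨cmb 1 (m-3) 1 3 0 0, cmb_anti _ _ _ _ _, ?_, ?_, ?_, ?_, ?_, ?_⟩
      · intro j
        have := @hc j (m-2)
        unfold cmb; split_ifs <;> omega
      · rw [sum_cmb] <;> omega
      · unfold cmb; split_ifs <;> omega
      · unfold cmb; split_ifs <;> omega
      · rintro ⟨j, hj, hj'⟩
        have e1 := hj' (m-2)
        have e2 := hj' (m-3)
        have := @hc (m-3) (m-2) (by omega)
        simp only [cmb] at e1 e2
        grind
      · rintro ⟨j, hj, hj'⟩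
        have := hc (Nat.zero_le j)
        simp only at hj; omega
  by_cases hQ : Bad (fun j => c j - cmb 1 m 0 0 0 0 j) (m-1)
  · obtain ⟨j0, h0, h1⟩ := hQ
    simp only [cmb] at h0 h1
    have hj00 : j0 = 0 := by
      by_contra hcon
      have := h1 0 (by omega)
      have := hc (Nat.zero_le j0)
      grind
    subst hj00
    have hc0 : c 0 = m := by grind
    refine ⟨cmb 1 (m-2) 2 1 0 0, cmb_anti _ _ _ _ _, ?_, ?_, ?_, ?_, ?_, ?_⟩
    · intro j
      by_cases hj : j = 0
      · subst hj; unfold cmb; split_ifs <;> omega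
      have := @hc j (m-1)
      unfold cmb; split_ifs <;> omega
    · rw [sum_cmb] <;> omega
    · unfold cmb; split_ifs <;> omega
    · unfold cmb; split_ifs <;> omega
    · rintro ⟨j, hj, hj'⟩
      have e1 := hj' 0
      by_cases hj0 : j = 0
      · subst hj0; simp only [cmb] at hj; grind
      · simp only [cmb] at e1; grind
    · rintro ⟨j, hj, hj'⟩
      have e1 := hj' 0
      by_cases hj0 : j = 0
      · subst hj0; simp only [cmb] at hj; grind
      · simp only [cmb] at e1; grind
  refine ⟨cmb 1 m 0 0 0 0, cmb_anti _ _ _ _ _, ?_, ?_, ?_, ?_, hP, hQ⟩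
  · intro j
    have := @hc j (m-1)
    unfold cmb; split_ifs <;> omega
  · rw [sum_cmb] <;> omega
  · unfold cmb; split_ifs <;> omega
  · unfold cmb; split_ifs <;> omega

set_option maxHeartbeats 4000000 in
theorem caseB (m N : ℕ) (hm : 11 ≤ m) (c : ℕ → ℕ) (hc : Antitone c)
    (hNm : 2 * m + 1 ≤ N) (hs : ∑ j ∈ range N, c j = 2 * m) (h : m ≤ c 0) :
    (c 0 = 2 * m - 1 ∧ c 1 = 1 ∧ c 2 = 0) ∨ ∃ a, Ok m N c a := by
  by_cases hP : Bad (fun j => c j - cmb m 1 0 0 0 0 j) 2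
  · right
    obtain ⟨j0, h0, h1⟩ := hP
    simp only [cmb] at h0 h1
    have hall : ∀ j, c j - (if j < 1 then m else 0) ≤ 2 := by
      intro j
      by_cases hj : j = j0
      · subst hj; grind
      · have := h1 j hj; grind
    have hc0 : c 0 ≤ m + 2 := by have := hall 0; grind
    have hc1 : ∀ j, 1 ≤ j → c j ≤ 2 := by intro j hj; have := hall j; grind
    have hc3 : 1 ≤ c 3 := by
      by_contra hcon
      have := ub hs (m+2) 1 2 3 0 0 (by omega) (by omega) (by omega) (by
        intro j hj
        have := @hc 3 j
        have := hc1 j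
        by_cases hj : j = 0
        · subst hj; unfold cmb; split_ifs <;> omega
        unfold cmb; split_ifs <;> omega)
      omega
    refine ⟨cmb (m-4) 1 1 4 0 0, cmb_anti _ _ _ _ _, ?_, ?_, ?_, ?_, ?_, ?_⟩
    · intro j
      by_cases hj : j = 0
      · subst hj; unfold cmb; split_ifs <;> omega
      have := @hc j 3
      unfold cmb; split_ifs <;> omega
    · rw [sum_cmb] <;> omega
    · unfold cmb; split_ifs <;> omega
    · unfold cmb; split_ifs <;> omega
    · rintro ⟨j, hj, hj'⟩
      have e1 := hj' 0
      by_cases hj0 : j = 0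
      · subst hj0; simp only [cmb] at hj; grind
      · simp only [cmb] at e1; grind
    · rintro ⟨j, hj, hj'⟩
      have e1 := hj' 0
      by_cases hj0 : j = 0
      · subst hj0; simp only [cmb] at hj; grind
      · simp only [cmb] at e1; grind
  by_cases hQ : Bad (fun j => c j - cmb m 1 0 0 0 0 j) (m-1)
  · obtain ⟨j0, h0, h1⟩ := hQ
    simp only [cmb] at h0 h1
    by_cases hj0 : j0 = 0
    · left
      subst hj0
      have hc0 : c 0 = 2 * m - 1 := by grind
      have e1 : 1 ≤ c 1 := by
        by_contra hcon
        have := ub hs (2*m-1) 1 0 0 0 0 (by omega) (by omega) (by omega) (by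
          intro j hj
          by_cases hj : j = 0
          · subst hj; unfold cmb; split_ifs <;> omega
          have := @hc 1 j
          unfold cmb; split_ifs <;> omega)
        omega
      have e2 : c 2 = 0 := by
        by_contra hcon
        have := lb hs (2*m-2) 1 1 3 0 0 (by omega) (by omega) (by omega) (by
          intro j hj
          by_cases hj : j = 0
          · subst hj; unfold cmb; split_ifs <;> omega
          have := @hc j 2
          unfold cmb; split_ifs <;> omega)
        omega
      have := h1 1 (by omega)
      refine ⟨hc0, ?_, e2⟩
      grind
    · right
      have hcj : c j0 = m - 1 := by grind
      have hj1 : j0 = 1 := by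
        by_contra hcon
        have := h1 1 (by omega)
        have := @hc 1 j0 (by omega)
        grind
      subst hj1
      have hc0 : c 0 ≤ m + 1 := by
        have := h1 0 (by omega)
        grind
      refine ⟨cmb (m-4) 1 2 2 0 0, cmb_anti _ _ _ _ _, ?_, ?_, ?_, ?_, ?_, ?_⟩
      · intro j
        by_cases hj : j = 0
        · subst hj; unfold cmb; split_ifs <;> omega
        have := @hc j 1
        unfold cmb; split_ifs <;> omega
      · rw [sum_cmb] <;> omega
      · unfold cmb; split_ifs <;> omega
      · unfold cmb; split_ifs <;> omega
      · rintro ⟨j, hj, hj'⟩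
        have e1 := hj' 1
        by_cases hj0 : j = 1
        · subst hj0; simp only [cmb] at hj; grind
        · simp only [cmb] at e1; grind
      · rintro ⟨j, hj, hj'⟩
        have e1 := hj' 1
        by_cases hj0 : j = 1
        · subst hj0; simp only [cmb] at hj; grind
        · simp only [cmb] at e1; grind
  right
  refine ⟨cmb m 1 0 0 0 0, cmb_anti _ _ _ _ _, ?_, ?_, ?_, ?_, hP, hQ⟩
  · intro j
    by_cases hj : j = 0
    · subst hj; unfold cmb; split_ifs <;> omega
    unfold cmb; split_ifs <;> omega
  · rw [sum_cmb] <;> omega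
  · unfold cmb; split_ifs <;> omega
  · unfold cmb; split_ifs <;> omega

theorem dsum (m N : ℕ) (c : ℕ → ℕ) (hs : ∑ j ∈ range N, c j = 2 * m) (a : ℕ → ℕ) (hle : ∀ j, a j ≤ c j) (ha : ∑ j ∈ range N, a j = m) :
    ∑ j ∈ range N, (c j - a j) = m := by
  have h2 : ∑ j ∈ range N, ((c j - a j) + a j) = ∑ j ∈ range N, c j := by
    refine Finset.sum_congr rfl fun j _ => ?_
    have := hle j
    omega
  rw [Finset.sum_add_distrib] at h2
  omega

set_option maxHeartbeats 4000000 in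
theorem caseC1 (m N : ℕ) (hm : 11 ≤ m) (c : ℕ → ℕ) (hc : Antitone c) (hN : c N = 0)
    (hNm : 2 * m + 1 ≤ N) (hs : ∑ j ∈ range N, c j = 2 * m) (h0 : c 0 ≤ m - 1) (h : c (m - 2) = 0) : ∃ a, Ok m N c a := by
  have hb : Antitone (fun j => min (c j) 1) := by
    intro i j hij
    have := hc hij
    simp only; omega
  have hbs : ∑ j ∈ range N, min (c j) 1 ≤ m - 2 := by
    have := ub (S := ∑ j ∈ range N, min (c j) 1) rfl 1 (m-2) 0 0 0 0
      (by omega) (by omega) (by omega) (by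
        intro j hj
        have := @hc (m-2) j
        unfold cmb; split_ifs <;> omega)
    omega
  obtain ⟨a, h1, h2, h3, h4⟩ := interp N c _ hc hb (fun j => min_le_left _ _) hN
    (m - ∑ j ∈ range N, min (c j) 1) (by omega)
  have hsa : ∑ j ∈ range N, a j = m := by omega
  have hd := dsum m N c hs a h3 hsa
  refine ⟨a, h1, h3, hsa, ?_, ?_, ?_, ?_⟩
  · rintro ⟨-, -, e⟩
    have := h3 (m-2); omega
  · rintro ⟨-, -, e⟩
    have e2 := h2 2
    have := ub hs (m-1) 2 0 0 0 0 (by omega) (by omega) (by omega) (by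
      intro j hj
      have := @hc 2 j
      have := @hc 0 j
      unfold cmb; split_ifs <;> omega)
    omega
  · rintro ⟨j0, e0, e1⟩
    simp only at e0 e1
    have hj0 : j0 < m - 2 := by
      by_contra hcon
      have := hc (not_lt.mp hcon)
      omega
    have := ub hd 1 (m-2) 0 0 1 j0 (by omega) (by omega) (by omega) (by
      intro j hj
      have := @hc (m-2) j
      have := e1 j
      by_cases hjj : j = j0
      · subst hjj; unfold cmb; split_ifs <;> omega
      · unfold cmb; split_ifs <;> omega)
    omega
  · rintro ⟨j0, e0, e1⟩
    have := h2 j0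
    have := hc (Nat.zero_le j0)
    simp only at *
    omega

set_option maxHeartbeats 4000000 in
theorem caseC2 (m N : ℕ) (hm : 11 ≤ m) (c : ℕ → ℕ) (hc : Antitone c)
    (hNm : 2 * m + 1 ≤ N) (hs : ∑ j ∈ range N, c j = 2 * m) (h0 : c 0 ≤ m - 1) (h : 1 ≤ c (m - 2)) (h' : c (m - 1) = 0) :
    ∃ a, Ok m N c a := by
  by_cases hk : 2 ≤ c (m - 3)
  · have hle : ∀ j, cmb 1 (m-4) 1 4 0 0 j ≤ c j := by
      intro j
      have := @hc j (m-3)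
      unfold cmb; split_ifs <;> omega
    refine ⟨cmb 1 (m-4) 1 4 0 0, cmb_anti _ _ _ _ _, hle, ?_, ?_, ?_, ?_, ?_⟩
    · rw [sum_cmb] <;> omega
    · unfold cmb; split_ifs <;> omega
    · unfold cmb; split_ifs <;> omega
    · rintro ⟨j, hj, hj'⟩
      have e1 := hj' (m-4)
      have e2 := hj' (m-3)
      have := @hc (m-4) (m-3) (by omega)
      simp only [cmb] at e1 e2
      grind
    · rintro ⟨j, hj, hj'⟩
      have hjm : m - 4 ≤ j := by
        by_contra hcon
        have := hc (Nat.zero_le j)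
        simp only [cmb] at hj
        grind
      have := lb hs (m-1) 3 0 0 0 0 (by omega) (by omega) (by omega) (by
        intro i hi
        have := @hc i j
        simp only at hj
        unfold cmb; split_ifs <;> omega)
      omega
  · have hc1 : 2 ≤ c 1 := by
      by_contra hcon
      have := ub hs (m-2) 1 1 (m-1) 0 0 (by omega) (by omega) (by omega) (by
        intro j hj
        have := @hc 1 j
        have := @hc (m-1) j
        by_cases hj : j = 0
        · subst hj; unfold cmb; split_ifs <;> omega
        unfold cmb; split_ifs <;> omega)
      omega
    have hle : ∀ j, cmb 1 (m-2) 1 2 0 0 j ≤ c j := by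
      intro j
      have := @hc j 1
      have := @hc j (m-2)
      unfold cmb; split_ifs <;> omega
    have hsa : ∑ j ∈ range N, cmb 1 (m-2) 1 2 0 0 j = m := by
      rw [sum_cmb] <;> omega
    have hd := dsum m N c hs _ hle hsa
    refine ⟨cmb 1 (m-2) 1 2 0 0, cmb_anti _ _ _ _ _, hle, hsa, ?_, ?_, ?_, ?_⟩
    · unfold cmb; split_ifs <;> omega
    · unfold cmb; split_ifs <;> omega
    · rintro ⟨j0, e0, e1⟩
      simp only at e0 e1
      have hj0 : j0 < m - 3 := by
        by_contra hcon
        have := hc (not_lt.mp hcon)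
        omega
      have hd' : ∑ j ∈ range N, ((c j - cmb 1 (m-2) 1 2 0 0 j) + if j = m - 3 then 1 else 0)
          = m + 1 := by
        rw [Finset.sum_add_distrib, hd, Finset.sum_ite_eq' (range N) (m-3) (fun _ => 1),
          if_pos (Finset.mem_range.mpr (by omega))]
      have := ub hd' 1 (m-1) 0 0 1 j0 (by omega) (by omega) (by omega) (by
        intro j hj
        have q1 := @hc (m-3) j
        have q2 := @hc (m-1) j
        have q3 := e1 j
        by_cases hjj : j = j0
        · subst hjj; simp only [cmb] at *; grind
        · simp only [cmb] at *; grind)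
      omega
    · rintro ⟨j0, e0, e1⟩
      have q1 := @hc (m-3) j0
      have q2 := @hc 0 j0
      simp only [cmb] at e0
      grind

theorem special (m : ℕ) (hm : 11 ≤ m) (lam : YoungDiagram)
    (h0 : lam.colLen 0 = 2 * m - 1) (h1 : lam.colLen 1 = 1) (h2 : lam.colLen 2 = 0) :
    ∃ alp bet : YoungDiagram, alp.card = m ∧ bet.card = m ∧
      alp.rowLens ≠ [m - 1, 1] ∧ alp.rowLens ≠ 2 :: List.replicate (m - 2) 1 ∧
      bet.rowLens ≠ [m - 1, 1] ∧ bet.rowLens ≠ 2 :: List.replicate (m - 2) 1 ∧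
      0 < lrCoeff alp bet lam := by
  classical
  set f : ℕ → ℕ := fun j => if j = 0 then m else 0 with hf
  have hfA : Antitone f := by
    intro i j hij
    simp only [hf]; split_ifs <;> omega
  have hf1 : f 1 = 0 := rfl
  set alp := ofCol f 1 hfA
  have hac : ∀ j, alp.colLen j = if j = 0 then m else 0 := colLen_ofCol hfA hf1
  have hcard : alp.card = m := by
    rw [card_eq_sum alp 1 (by rw [hac]; rfl)]; simp [hac]
  have hr : ∀ v, alp.rowLen v = if v < m then 1 else 0 := by
    intro v
    have e1 := lt_iff alp v 0
    have e2 := lt_iff alp v 1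
    rw [hac] at e1 e2
    simp only [if_true] at e1
    rw [if_neg (by omega)] at e2
    split_ifs <;> omega
  have g1 : alp.rowLens ≠ [m - 1, 1] := by
    intro h
    have := (bad1 _ _ h).1
    rw [hr, if_pos (by omega)] at this
    omega
  have g2 : alp.rowLens ≠ 2 :: List.replicate (m - 2) 1 := by
    intro h
    have := (bad2 _ _ hm h).1
    rw [hr, if_pos (by omega)] at this
    omega
  have hmem : ∀ i j, (i, j) ∈ lam.cells \ alp.cells ↔
      (j = 0 ∧ m ≤ i ∧ i < 2 * m - 1) ∨ (j = 1 ∧ i = 0) := by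
    intro i j
    rw [mem_skew, hac]
    match j with
    | 0 => rw [h0]; simp
    | 1 => rw [h1]; simp
    | (k + 2) =>
      have := lam.colLen_anti 2 (k + 2) (by omega)
      omega
  obtain ⟨E, hE⟩ : ∃ E : ℕ → ℕ → ℕ, ∀ i j,
      (j = 0 ∧ m ≤ i ∧ i < 2 * m - 1 ∧ E i j = i - m + 1) ∨
      (¬ (j = 0 ∧ m ≤ i ∧ i < 2 * m - 1) ∧ E i j = 0) := by
    refine ⟨fun i j => if j = 0 ∧ m ≤ i ∧ i < 2 * m - 1 then i - m + 1 else 0, ?_⟩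
    intro i j
    by_cases h : j = 0 ∧ m ≤ i ∧ i < 2 * m - 1
    · left; simp only [if_pos h]; exact ⟨h.1, h.2.1, h.2.2, trivial⟩
    · right; simp only [if_neg h]; exact ⟨h, trivial⟩
  refine ⟨alp, alp, hcard, hcard, g1, g2, g1, g2, lr_pos ⟨E, ?_, ?_, ?_, ?_, ?_⟩⟩
  · intro i j h
    rw [hmem] at h
    have := hE i j
    omega
  · intro i j1 j2 h e1 e2
    rw [hmem] at e1 e2
    have := hE i j1
    have := hE i j2
    omega
  · intro i1 i2 j h e1 e2
    rw [hmem] at e1 e2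
    have := hE i1 j
    have := hE i2 j
    omega
  · intro v
    rw [hr]
    split_ifs with hv
    · rw [Finset.card_eq_one]
      refine ⟨if v = 0 then (0, 1) else (m + v - 1, 0), ?_⟩
      ext ⟨i, j⟩
      rw [Finset.mem_filter, hmem, Finset.mem_singleton]
      have := hE i j
      split_ifs <;> simp only [Prod.mk.injEq] <;> omega
    · rw [Finset.card_eq_zero, Finset.filter_eq_empty_iff]
      rintro ⟨i, j⟩ hh
      rw [hmem] at hh
      have := hE i j
      simp only
      omega
  · intro i j v h
    rw [hmem] at h
    refine Finset.card_le_card_of_injOn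
      (fun _ => if v = 0 then (0, 1) else (m + v - 1, 0)) ?_ ?_
    · rintro ⟨a, b⟩ hab
      rw [Finset.mem_coe, Finset.mem_filter, hmem] at hab
      rw [Finset.mem_coe, Finset.mem_filter]
      have e := hE a b
      simp only at hab
      by_cases hv : v = 0
      · simp only [if_pos hv]
        rw [hmem]
        have := hE 0 1
        omega
      · simp only [if_neg hv]
        rw [hmem]
        have := hE (m + v - 1) 0
        omega
    · rintro ⟨a, b⟩ hab ⟨a', b'⟩ hab' _
      rw [Finset.mem_coe, Finset.mem_filter, hmem] at hab hab'
      have e := hE a b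
      have e' := hE a' b'
      simp only at hab hab'
      rw [Prod.mk.injEq]
      omega

end LRAux

/-- Let `m ≥ 11`.  For every partition `λ` of `2m` there exist
partitions `α, β` of `m`, neither equal to `(m−1,1)` nor to `(2,1^{m−2})`, with
`c^λ_{αβ} > 0`. -/
theorem exists_LR_pair_avoiding_standard (m : ℕ) (hm : 11 ≤ m) (lam : YoungDiagram)
    (hcard : lam.card = 2 * m) :
    ∃ alp bet : YoungDiagram, alp.card = m ∧ bet.card = m ∧
      alp.rowLens ≠ [m - 1, 1] ∧ alp.rowLens ≠ 2 :: List.replicate (m - 2) 1 ∧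
      bet.rowLens ≠ [m - 1, 1] ∧ bet.rowLens ≠ 2 :: List.replicate (m - 2) 1 ∧
      0 < lrCoeff alp bet lam := by
  have hN : lam.colLen (lam.rowLen 0 + 2 * m + 1) = 0 := by
    have := LRAux.lt_iff lam 0 (lam.rowLen 0 + 2 * m + 1)
    omega
  have hs := LRAux.card_eq_sum lam _ hN
  rw [hcard] at hs
  have hc : Antitone lam.colLen := fun i j h => lam.colLen_anti i j h
  have key : (lam.colLen 0 = 2 * m - 1 ∧ lam.colLen 1 = 1 ∧ lam.colLen 2 = 0) ∨
      ∃ a, LRAux.Ok m (lam.rowLen 0 + 2 * m + 1) lam.colLen a := by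
    by_cases hA : 1 ≤ lam.colLen (m - 1)
    · exact Or.inr (LRAux.caseA m _ hm _ hc (by omega) hs.symm hA)
    by_cases hB : m ≤ lam.colLen 0
    · exact LRAux.caseB m _ hm _ hc (by omega) hs.symm hB
    by_cases hC : lam.colLen (m - 2) = 0
    · exact Or.inr (LRAux.caseC1 m _ hm _ hc hN (by omega) hs.symm (by omega) hC)
    · exact Or.inr (LRAux.caseC2 m _ hm _ hc (by omega) hs.symm (by omega) (by omega) (by omega))
  rcases key with ⟨h0, h1, h2⟩ | ⟨a, k1, k2, k3, k4, k5, k6, k7⟩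
  · exact LRAux.special m hm lam h0 h1 h2
  · exact LRAux.reduce m hm lam hcard _ hN a k1 k2 k3 k4 k5 k6 k7
end

section
/- Let m ≥ 11 and let λ be a partition of 3m with λ_1 ≤ 3m − 6 and λ'_1 ≤ 3m − 6 (first part and number of parts both at most 3m − 6). Then there exist pairwise distinct partitions α, β, γ of m, none equal to (m) or (1^m), such that s_α s_β s_γ − s_λ is Schur-positive restricted to the coefficient of s_λ; i.e. the coefficient of s_λ in s_α s_β s_γ is positive. -/
namespace LRaux
open Finset

/-- number of indices `i < N` with `j < u i` -/
def cnt (N : ℕ) (u : ℕ → ℕ) (j : ℕ) : ℕ := Nat.count (fun i => j < u i) N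

theorem cnt_anti (N : ℕ) (u : ℕ → ℕ) {j j' : ℕ} (h : j ≤ j') : cnt N u j' ≤ cnt N u j := by
  unfold cnt
  exact Nat.count_mono_left (fun k _ hk => lt_of_le_of_lt h hk)

theorem exists_of_lt_count (p : ℕ → Prop) [DecidablePred p] (v : ℕ) : ∀ N : ℕ,
    v < Nat.count p N → ∃ i < N, p i ∧ Nat.count p i = v := by
  intro N
  induction N with
  | zero => intro h; simp at h
  | succ n ih =>
    intro h
    by_cases hv : v < Nat.count p n
    · obtain ⟨i, hi, h2⟩ := ih hv
      exact ⟨i, by omega, h2⟩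
    · rw [Nat.count_succ] at h
      by_cases hp : p n
      · simp only [hp, if_true] at h
        exact ⟨n, by omega, hp, by omega⟩
      · simp only [hp, if_false] at h
        omega

theorem cnt_pos_lt {N : ℕ} {u : ℕ → ℕ} {v j : ℕ} (h : v < cnt N u j) :
    v < N ∧ j < ∑ i ∈ range N, u i := by
  constructor
  · exact lt_of_lt_of_le h (Nat.count_le _)
  · obtain ⟨i, hi, h2, _⟩ := exists_of_lt_count _ v N h
    exact lt_of_lt_of_le h2 (single_le_sum (f := u) (fun _ _ => Nat.zero_le _) (mem_range.2 hi))

/-- the diagram whose rows are the values of `u`, sorted -/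
def cd (N : ℕ) (u : ℕ → ℕ) : YoungDiagram where
  cells := ((range N) ×ˢ (range (∑ i ∈ range N, u i))).filter (fun c => c.1 < cnt N u c.2)
  isLowerSet := by
    rintro ⟨a, b⟩ ⟨c, d⟩ hle h
    simp only [coe_filter, mem_product, Set.mem_ofPred_eq] at h ⊢
    obtain ⟨h1, h2⟩ := Prod.mk_le_mk.1 hle
    have h3 : c < cnt N u d := lt_of_le_of_lt h1 (lt_of_lt_of_le h.2 (cnt_anti N u h2))
    have := cnt_pos_lt h3
    simp only [mem_range]
    exact ⟨this, h3⟩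

theorem mem_cd {N : ℕ} {u : ℕ → ℕ} {v j : ℕ} : (v, j) ∈ cd N u ↔ v < cnt N u j := by
  rw [← YoungDiagram.mem_cells]
  simp only [cd, mem_filter, mem_product, mem_range]
  exact ⟨fun h => h.2, fun h => ⟨cnt_pos_lt h, h⟩⟩

theorem colLen_cd (N : ℕ) (u : ℕ → ℕ) (j : ℕ) : (cd N u).colLen j = cnt N u j := by
  have h : ∀ v, v < (cd N u).colLen j ↔ v < cnt N u j := fun v => by
    rw [← YoungDiagram.mem_iff_lt_colLen, mem_cd]
  have h1 := h ((cd N u).colLen j)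
  have h2 := h (cnt N u j)
  omega

theorem card_cd (N : ℕ) (u : ℕ → ℕ) : (cd N u).card = ∑ i ∈ range N, u i := by
  set B := ∑ i ∈ range N, u i with hB
  have h0 : (cd N u).card = (((range N) ×ˢ (range B)).filter (fun c => c.1 < cnt N u c.2)).card := rfl
  rw [h0, card_filter, sum_product_right]
  have h1 : ∀ j ∈ range B, (∑ v ∈ range N, if v < cnt N u j then 1 else 0) =
      ∑ i ∈ range N, if j < u i then 1 else 0 := by
    intro j _
    rw [← card_filter, ← card_filter]
    have : cnt N u j ≤ N := Nat.count_le _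
    have h2 : (range N).filter (fun v => v < cnt N u j) = range (cnt N u j) := by
      ext v; simp only [mem_filter, mem_range]; omega
    rw [h2, card_range, cnt, Nat.count_eq_card_filter_range]
  rw [sum_congr rfl h1, sum_comm]
  apply sum_congr rfl
  intro i hi
  rw [← card_filter]
  have h3 : u i ≤ B := single_le_sum (f := u) (fun _ _ => Nat.zero_le _) hi
  have h2 : (range B).filter (fun j => j < u i) = range (u i) := by
    ext v; simp only [mem_filter, mem_range]; omega
  rw [h2, card_range]

theorem count_anti (x : ℕ → ℕ) (hx : Antitone x) (j : ℕ) : ∀ N v : ℕ,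
    v < Nat.count (fun i => j < x i) N ↔ (v < N ∧ j < x v) := by
  intro N
  induction N with
  | zero => intro v; simp
  | succ n ih =>
    intro v
    rw [Nat.count_succ]
    have hle : Nat.count (fun i => j < x i) n ≤ n := Nat.count_le _
    by_cases hp : j < x n
    · simp only [hp, if_true]
      have : Nat.count (fun i => j < x i) n = n := by
        rcases Nat.eq_zero_or_pos n with h | h
        · subst h; simp
        · have := (ih (n-1)).2 ⟨by omega, lt_of_lt_of_le hp (hx (by omega))⟩
          omega
      rw [this]
      constructor
      · intro h; exact ⟨h, lt_of_lt_of_le hp (hx (by omega))⟩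
      · exact fun h => h.1
    · simp only [hp, if_false, add_zero]
      rw [ih]
      constructor
      · rintro ⟨h1, h2⟩; exact ⟨by omega, h2⟩
      · rintro ⟨h1, h2⟩
        refine ⟨?_, h2⟩
        rcases Nat.lt_or_ge v n with h | h
        · exact h
        · exact absurd (lt_of_lt_of_le h2 (hx h)) hp

theorem rowLen_cd (N : ℕ) (x : ℕ → ℕ) (hx : Antitone x) (h0 : ∀ i, N ≤ i → x i = 0) (v : ℕ) :
    (cd N x).rowLen v = x v := by
  have h : ∀ j, j < (cd N x).rowLen v ↔ j < x v := fun j => by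
    rw [← YoungDiagram.mem_iff_lt_rowLen, mem_cd, cnt, count_anti x hx]
    constructor
    · exact fun h => h.2
    · intro h
      refine ⟨?_, h⟩
      by_contra hc
      have := h0 v (by omega)
      omega
  have h1 := h ((cd N x).rowLen v)
  have h2 := h (x v)
  omega

theorem mem_skew {lam eta : YoungDiagram} {i j : ℕ} :
    (i, j) ∈ lam.cells \ eta.cells ↔ j < lam.rowLen i ∧ eta.rowLen i ≤ j := by
  rw [mem_sdiff, YoungDiagram.mem_cells, YoungDiagram.mem_cells, YoungDiagram.mem_iff_lt_rowLen,
    YoungDiagram.mem_iff_lt_rowLen, not_lt]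

theorem mem_skew' {lam eta : YoungDiagram} {i j : ℕ} :
    (i, j) ∈ lam.cells \ eta.cells ↔ i < lam.colLen j ∧ eta.colLen j ≤ i := by
  rw [mem_sdiff, YoungDiagram.mem_cells, YoungDiagram.mem_cells, YoungDiagram.mem_iff_lt_colLen,
    YoungDiagram.mem_iff_lt_colLen, not_lt]

theorem finite_LR (lam eta bet : YoungDiagram) : Finite (LRSkewTableau lam eta bet) := by
  have hb : ∀ (T : LRSkewTableau lam eta bet) (i j : ℕ), T.entry i j < bet.colLen 0 + 1 := by
    intro T i j
    by_cases h : (i, j) ∈ lam.cells \ eta.cells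
    · have h1 := T.content (T.entry i j)
      have h2 : 0 < bet.rowLen (T.entry i j) := by
        rw [← h1, card_pos]
        exact ⟨(i, j), mem_filter.2 ⟨h, rfl⟩⟩
      rw [← YoungDiagram.mem_iff_lt_rowLen, YoungDiagram.mem_iff_lt_colLen] at h2
      omega
    · rw [T.zero_out i j h]; omega
  refine Finite.of_injective (β := (lam.cells → Fin (bet.colLen 0 + 1)))
    (fun T c => ⟨T.entry c.1.1 c.1.2, hb T _ _⟩) ?_
  intro T S h
  have key : T.entry = S.entry := by
    funext i j
    by_cases hc : (i, j) ∈ lam.cells \ eta.cells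
    · have := congrFun h ⟨(i, j), (mem_sdiff.1 hc).1⟩
      simpa using this
    · rw [T.zero_out i j hc, S.zero_out i j hc]
  cases T; cases S
  simp only at key
  subst key
  rfl

theorem lr_pos {lam eta bet : YoungDiagram} (T : LRSkewTableau lam eta bet) :
    0 < lrCoeff eta bet lam := by
  have := finite_LR lam eta bet
  have : Nonempty (LRSkewTableau lam eta bet) := ⟨T⟩
  exact Nat.card_pos

/-- the row filling -/
def rowEntry (lam eta : YoungDiagram) (i j : ℕ) : ℕ :=
  Nat.count (fun i' => lam.rowLen i - j - 1 < lam.rowLen i' - eta.rowLen i') i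

theorem lr_row (lam eta : YoungDiagram) (N : ℕ) (hN : ∀ i, N ≤ i → lam.rowLen i = 0) :
    0 < lrCoeff eta (cd N (fun i => lam.rowLen i - eta.rowLen i)) lam := by
  set S := lam.cells \ eta.cells with hS
  let E : ℕ → ℕ → ℕ := fun i j => if (i, j) ∈ S then rowEntry lam eta i j else 0
  have hE : ∀ i j, (i, j) ∈ S → E i j = rowEntry lam eta i j := fun i j h => if_pos h
  let J : ℕ × ℕ → ℕ := fun c => lam.rowLen c.1 - c.2 - 1
  -- injectivity of `J` on the cells with a given letter
  have hinj : ∀ c d : ℕ × ℕ, c ∈ S → d ∈ S → E c.1 c.2 = E d.1 d.2 → J c = J d → c = d := by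
    rintro ⟨i, j⟩ ⟨i', j'⟩ hc hd he hJ
    simp only [J] at hJ
    simp only at he
    rw [hE _ _ hc, hE _ _ hd, rowEntry, rowEntry, hJ] at he
    have h1 := mem_skew.1 hc
    have h2 := mem_skew.1 hd
    have : i = i' := by
      refine Nat.count_injective (p := fun k => lam.rowLen i' - j' - 1 <
        lam.rowLen k - eta.rowLen k) ?_ ?_ he
      · rw [← hJ]; omega
      · omega
    subst this
    have : j = j' := by omega
    rw [this]
  -- existence of a cell with given letter and parameter
  have hex : ∀ n v j : ℕ, v < Nat.count (fun k => j < lam.rowLen k - eta.rowLen k) n →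
      ∃ c ∈ S, c.1 < n ∧ E c.1 c.2 = v ∧ J c = j := by
    intro n v j h
    obtain ⟨i, hi, h2, h3⟩ := exists_of_lt_count _ v n h
    have hm : (i, lam.rowLen i - j - 1) ∈ S := mem_skew.2 ⟨by omega, by omega⟩
    have hj : lam.rowLen i - (lam.rowLen i - j - 1) - 1 = j := by omega
    refine ⟨_, hm, hi, ?_, ?_⟩
    · simp only
      rw [hE _ _ hm, rowEntry, hj]; exact h3
    · exact hj
  refine lr_pos (⟨E, ?_, ?_, ?_, ?_, ?_⟩ : LRSkewTableau lam eta _)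
  · intro i j h
    exact if_neg h
  · intro i j1 j2 hle h1 h2
    rw [hE _ _ h1, hE _ _ h2]
    exact Nat.count_mono_left (fun k _ hk => by omega)
  · intro i1 i2 j hlt h1 h2
    rw [hE _ _ h1, hE _ _ h2, rowEntry, rowEntry]
    have e1 := mem_skew.1 h1
    have e2 := mem_skew.1 h2
    have hanti := lam.rowLen_anti i1 i2 hlt.le
    have a1 : Nat.count (fun i' => lam.rowLen i1 - j - 1 < lam.rowLen i' - eta.rowLen i') i1 ≤
      Nat.count (fun i' => lam.rowLen i2 - j - 1 < lam.rowLen i' - eta.rowLen i') i1 :=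
      Nat.count_mono_left (fun k _ hk => by omega)
    have a2 : Nat.count (fun i' => lam.rowLen i2 - j - 1 < lam.rowLen i' - eta.rowLen i') i1 <
      Nat.count (fun i' => lam.rowLen i2 - j - 1 < lam.rowLen i' - eta.rowLen i') i2 := by
      apply Nat.count_strict_mono _ hlt
      omega
    omega
  · intro v
    have hcard : (S.filter (fun c => E c.1 c.2 = v)).card =
        ((S.filter (fun c => E c.1 c.2 = v)).image J).card := by
      symm
      apply card_image_of_injOn
      intro c hc d hd hJ
      simp only [coe_filter, Set.mem_ofPred_eq] at hc hd
      exact hinj c d hc.1 hd.1 (hc.2.trans hd.2.symm) hJ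
    rw [hcard]
    have : (S.filter (fun c => E c.1 c.2 = v)).image J =
        range ((cd N (fun i => lam.rowLen i - eta.rowLen i)).rowLen v) := by
      ext j
      rw [mem_range, ← YoungDiagram.mem_iff_lt_rowLen, mem_cd, cnt]
      simp only [mem_image, mem_filter]
      constructor
      · rintro ⟨⟨i, c⟩, ⟨h1, h2⟩, h3⟩
        have e1 := mem_skew.1 h1
        simp only at h2
        rw [hE _ _ h1, rowEntry] at h2
        simp only [J] at h3
        rw [h3] at h2
        rw [← h2]
        apply Nat.count_strict_mono
        · omega
        · by_contra hc
          have := hN i (by omega)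
          omega
      · intro h
        obtain ⟨c, h1, h2, h3, h4⟩ := hex N v j h
        exact ⟨c, ⟨h1, h3⟩, h4⟩
    rw [this, card_range]
  · intro i j v hij
    set A := S.filter (fun c => (c.1 < i ∨ (c.1 = i ∧ j ≤ c.2)) ∧ E c.1 c.2 = v + 1) with hA
    set B := S.filter (fun c => (c.1 < i ∨ (c.1 = i ∧ j ≤ c.2)) ∧ E c.1 c.2 = v) with hB
    have hcard : A.card = (A.image J).card := by
      symm
      apply card_image_of_injOn
      intro c hc d hd hJ
      simp only [hA, coe_filter, Set.mem_ofPred_eq] at hc hd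
      exact hinj c d hc.1 hd.1 (hc.2.2.trans hd.2.2.symm) hJ
    rw [hcard]
    refine le_trans (card_le_card ?_) (card_image_le (s := B) (f := J))
    intro t ht
    simp only [mem_image, hA, hB, mem_filter] at ht ⊢
    obtain ⟨⟨a, b⟩, ⟨h1, h2, h3⟩, h4⟩ := ht
    simp only at h2 h3
    rw [hE _ _ h1, rowEntry] at h3
    simp only [J] at h4
    rw [h4] at h3
    obtain ⟨c, c1, c2, c3, c4⟩ := hex a v t (by omega)
    exact ⟨c, ⟨c1, by omega, c3⟩, c4⟩

theorem lr_col (lam eta : YoungDiagram) (N : ℕ) (hN : ∀ i, N ≤ i → lam.colLen i = 0) :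
    0 < lrCoeff eta (cd N (fun i => lam.colLen i - eta.colLen i)).transpose lam := by
  set S := lam.cells \ eta.cells with hS
  let E : ℕ → ℕ → ℕ := fun i j => if (i, j) ∈ S then i - eta.colLen j else 0
  have hE : ∀ i j, (i, j) ∈ S → E i j = i - eta.colLen j := fun i j h => if_pos h
  have hinj : ∀ c d : ℕ × ℕ, c ∈ S → d ∈ S → E c.1 c.2 = E d.1 d.2 → c.2 = d.2 → c = d := by
    rintro ⟨i, j⟩ ⟨i', j'⟩ hc hd he hJ
    simp only at hJ he
    subst hJ
    rw [hE _ _ hc, hE _ _ hd] at he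
    have h1 := mem_skew'.1 hc
    have h2 := mem_skew'.1 hd
    have : i = i' := by omega
    rw [this]
  refine lr_pos (⟨E, ?_, ?_, ?_, ?_, ?_⟩ : LRSkewTableau lam eta _)
  · intro i j h
    exact if_neg h
  · intro i j1 j2 hle h1 h2
    rw [hE _ _ h1, hE _ _ h2]
    have := eta.colLen_anti j1 j2 hle
    omega
  · intro i1 i2 j hlt h1 h2
    rw [hE _ _ h1, hE _ _ h2]
    have e1 := mem_skew'.1 h1
    omega
  · intro v
    have hcard : (S.filter (fun c => E c.1 c.2 = v)).card =
        ((S.filter (fun c => E c.1 c.2 = v)).image Prod.snd).card := by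
      symm
      apply card_image_of_injOn
      intro c hc d hd hJ
      simp only [coe_filter, Set.mem_ofPred_eq] at hc hd
      exact hinj c d hc.1 hd.1 (hc.2.trans hd.2.symm) hJ
    rw [hcard, YoungDiagram.rowLen_transpose, colLen_cd, cnt, Nat.count_eq_card_filter_range]
    congr 1
    ext j
    simp only [mem_image, mem_filter, mem_range]
    constructor
    · rintro ⟨⟨i, c⟩, ⟨h1, h2⟩, h3⟩
      simp only at h2 h3
      subst h3
      have e1 := mem_skew'.1 h1
      rw [hE _ _ h1] at h2
      refine ⟨?_, by omega⟩
      by_contra hc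
      have := hN c (by omega)
      omega
    · rintro ⟨h1, h2⟩
      have hm : (eta.colLen j + v, j) ∈ S := mem_skew'.2 ⟨by omega, by omega⟩
      refine ⟨_, ⟨hm, ?_⟩, rfl⟩
      simp only
      rw [hE _ _ hm]; omega
  · intro i j v hij
    set A := S.filter (fun c => (c.1 < i ∨ (c.1 = i ∧ j ≤ c.2)) ∧ E c.1 c.2 = v + 1) with hA
    set B := S.filter (fun c => (c.1 < i ∨ (c.1 = i ∧ j ≤ c.2)) ∧ E c.1 c.2 = v) with hB
    have hcard : A.card = (A.image Prod.snd).card := by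
      symm
      apply card_image_of_injOn
      intro c hc d hd hJ
      simp only [hA, coe_filter, Set.mem_ofPred_eq] at hc hd
      exact hinj c d hc.1 hd.1 (hc.2.2.trans hd.2.2.symm) hJ
    rw [hcard]
    refine le_trans (card_le_card ?_) (card_image_le (s := B) (f := Prod.snd))
    intro t ht
    simp only [mem_image, hA, hB, mem_filter] at ht ⊢
    obtain ⟨⟨a, b⟩, ⟨h1, h2, h3⟩, h4⟩ := ht
    simp only at h2 h3 h4
    subst h4
    rw [hE _ _ h1] at h3
    have e1 := mem_skew'.1 h1
    have hm : (a - 1, b) ∈ S := mem_skew'.2 ⟨by omega, by omega⟩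
    refine ⟨_, ⟨hm, ?_, ?_⟩, rfl⟩
    · simp only; omega
    · simp only
      rw [hE _ _ hm]; omega

/-- the sequence `u` has an entry at least two and all its entries are less than `m` -/
def Ok (m N : ℕ) (u : ℕ → ℕ) : Prop := (∃ i < N, 2 ≤ u i) ∧ ∀ i, u i < m

/-- the sorted sequences differ -/
def Df (N : ℕ) (u v : ℕ → ℕ) : Prop := ∃ j, cnt N u j ≠ cnt N v j

/-- the combinatorial condition on a row-length sequence -/
def Good (m N : ℕ) (f : ℕ → ℕ) : Prop :=
  ∃ x w : ℕ → ℕ, Antitone x ∧ Antitone w ∧ (∀ i, x i ≤ w i) ∧ (∀ i, w i ≤ f i) ∧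
    ∑ i ∈ range N, x i = m ∧ ∑ i ∈ range N, w i = 2 * m ∧
    Ok m N x ∧ Ok m N (fun i => w i - x i) ∧ Ok m N (fun i => f i - w i) ∧
    Df N x (fun i => w i - x i) ∧ Df N (fun i => w i - x i) (fun i => f i - w i) ∧
    Df N x (fun i => f i - w i)

theorem sum_sub (N : ℕ) (u v : ℕ → ℕ) (h : ∀ i, u i ≤ v i) :
    ∑ i ∈ range N, (v i - u i) + ∑ i ∈ range N, u i = ∑ i ∈ range N, v i := by
  rw [← sum_add_distrib]
  exact sum_congr rfl (fun i _ => Nat.sub_add_cancel (h i))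

/-- not a single row, not a single column -/
theorem non_ext {mu : YoungDiagram} {m : ℕ} (h1 : (0, 1) ∈ mu) (h2 : (1, 0) ∈ mu) :
    mu.rowLens ≠ [m] ∧ mu.rowLens ≠ List.replicate m 1 := by
  constructor
  · intro h
    have := congrArg List.length h
    rw [YoungDiagram.length_rowLens] at this
    rw [YoungDiagram.mem_iff_lt_colLen] at h2
    simp at this
    omega
  · intro h
    rw [YoungDiagram.mem_iff_lt_rowLen] at h1
    have h3 : mu.rowLen 0 ∈ mu.rowLens := by
      rw [YoungDiagram.rowLens, List.mem_map]
      refine ⟨0, ?_, rfl⟩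
      rw [List.mem_range]
      rw [YoungDiagram.mem_iff_lt_colLen] at h2
      omega
    rw [h] at h3
    have := List.eq_of_mem_replicate h3
    omega

theorem cnt_pos {N : ℕ} {u : ℕ → ℕ} {j i : ℕ} (hi : i < N) (h : j < u i) : 0 < cnt N u j := by
  rw [cnt, Nat.count_eq_card_filter_range, card_pos]
  exact ⟨i, by simp [hi, h]⟩

theorem ok_mem {m N : ℕ} {u : ℕ → ℕ} (h : Ok m N u) (hs : ∑ i ∈ range N, u i = m) :
    (0, 1) ∈ cd N u ∧ (1, 0) ∈ cd N u := by
  obtain ⟨⟨i, hi, h2⟩, hlt⟩ := h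
  refine ⟨mem_cd.2 (cnt_pos hi h2), mem_cd.2 ?_⟩
  have : ∃ k ∈ (range N).erase i, u k ≠ 0 := by
    by_contra hc
    push Not at hc
    have h3 := add_sum_erase (range N) u (mem_range.2 hi)
    rw [sum_eq_zero hc] at h3
    have := hlt i
    omega
  obtain ⟨k, hk, hk2⟩ := this
  rw [cnt, Nat.count_eq_card_filter_range, one_lt_card]
  have := mem_erase.1 hk
  exact ⟨i, by simp [hi]; omega, k, by simp [mem_range.1 this.2]; omega, fun h => this.1 h.symm⟩

theorem df_ne {N : ℕ} {u v : ℕ → ℕ} (h : Df N u v) : cd N u ≠ cd N v := by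
  obtain ⟨j, hj⟩ := h
  intro he
  apply hj
  rw [← colLen_cd, ← colLen_cd, he]

theorem tr_ne {a b : YoungDiagram} (h : a ≠ b) : a.transpose ≠ b.transpose := by
  intro he
  apply h
  rw [← YoungDiagram.transpose_transpose a, he, YoungDiagram.transpose_transpose]

theorem tr_card (a : YoungDiagram) : a.transpose.card = a.card := by
  simp [YoungDiagram.card, YoungDiagram.transpose]

theorem tr_mem {a : YoungDiagram} {i j : ℕ} (h : (i, j) ∈ a) : (j, i) ∈ a.transpose := by
  rw [YoungDiagram.mem_transpose]; exact h

/-- the conclusion of the main theorem -/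
def Concl (m : ℕ) (lam : YoungDiagram) : Prop :=
    ∃ alp bet gam : YoungDiagram,
      alp.card = m ∧ bet.card = m ∧ gam.card = m ∧
      alp ≠ bet ∧ bet ≠ gam ∧ alp ≠ gam ∧
      alp.rowLens ≠ [m] ∧ alp.rowLens ≠ List.replicate m 1 ∧
      bet.rowLens ≠ [m] ∧ bet.rowLens ≠ List.replicate m 1 ∧
      gam.rowLens ≠ [m] ∧ gam.rowLens ≠ List.replicate m 1 ∧
      ∃ eta : YoungDiagram, 0 < lrCoeff alp bet eta ∧ 0 < lrCoeff eta gam lam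

theorem concl_row {m N : ℕ} {lam : YoungDiagram} (hN : ∀ i, N ≤ i → lam.rowLen i = 0)
    (hs : ∑ i ∈ range N, lam.rowLen i = 3 * m) (hg : Good m N lam.rowLen) : Concl m lam := by
  obtain ⟨x, w, hx, hw, hxw, hwf, sx, sw, o1, o2, o3, d1, d2, d3⟩ := hg
  have w0 : ∀ i, N ≤ i → w i = 0 := fun i hi => by have := hwf i; have := hN i hi; omega
  have x0 : ∀ i, N ≤ i → x i = 0 := fun i hi => by have := hxw i; have := w0 i hi; omega
  have sy : ∑ i ∈ range N, (w i - x i) = m := by have := sum_sub N x w hxw; omega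
  have sz : ∑ i ∈ range N, (lam.rowLen i - w i) = m := by
    have := sum_sub N w lam.rowLen hwf; omega
  have e1 := ok_mem o1 sx
  have e2 := ok_mem o2 sy
  have e3 := ok_mem o3 sz
  have rw' := rowLen_cd N w hw w0
  have rx := rowLen_cd N x hx x0
  have l1 := lr_row (cd N w) (cd N x) N (fun i hi => by rw [rw', w0 i hi])
  have l2 := lr_row lam (cd N w) N hN
  simp only [rw', rx] at l1 l2
  exact ⟨cd N x, _, _, by rw [card_cd, sx], by rw [card_cd, sy], by rw [card_cd, sz],
    df_ne d1, df_ne d2, df_ne d3, (non_ext e1.1 e1.2).1, (non_ext e1.1 e1.2).2,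
    (non_ext e2.1 e2.2).1, (non_ext e2.1 e2.2).2,
    (non_ext e3.1 e3.2).1, (non_ext e3.1 e3.2).2, _, l1, l2⟩

theorem concl_col {m N : ℕ} {lam : YoungDiagram} (hN : ∀ i, N ≤ i → lam.colLen i = 0)
    (hs : ∑ i ∈ range N, lam.colLen i = 3 * m) (hg : Good m N lam.colLen) : Concl m lam := by
  obtain ⟨x, w, hx, hw, hxw, hwf, sx, sw, o1, o2, o3, d1, d2, d3⟩ := hg
  have w0 : ∀ i, N ≤ i → w i = 0 := fun i hi => by have := hwf i; have := hN i hi; omega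
  have x0 : ∀ i, N ≤ i → x i = 0 := fun i hi => by have := hxw i; have := w0 i hi; omega
  have sy : ∑ i ∈ range N, (w i - x i) = m := by have := sum_sub N x w hxw; omega
  have sz : ∑ i ∈ range N, (lam.colLen i - w i) = m := by
    have := sum_sub N w lam.colLen hwf; omega
  have e1 := ok_mem o1 sx
  have e2 := ok_mem o2 sy
  have e3 := ok_mem o3 sz
  have rw' := rowLen_cd N w hw w0
  have rx := rowLen_cd N x hx x0
  have l1 := lr_col (cd N w).transpose (cd N x).transpose N
    (fun i hi => by rw [YoungDiagram.colLen_transpose, rw', w0 i hi])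
  have l2 := lr_col lam (cd N w).transpose N hN
  simp only [YoungDiagram.colLen_transpose, rw', rx] at l1 l2
  have n1 := non_ext (m := m) (tr_mem e1.2) (tr_mem e1.1)
  have n2 := non_ext (m := m) (tr_mem e2.2) (tr_mem e2.1)
  have n3 := non_ext (m := m) (tr_mem e3.2) (tr_mem e3.1)
  exact ⟨(cd N x).transpose, _, _, by rw [tr_card, card_cd, sx], by rw [tr_card, card_cd, sy],
    by rw [tr_card, card_cd, sz],
    tr_ne (df_ne d1), tr_ne (df_ne d2), tr_ne (df_ne d3), n1.1, n1.2, n2.1, n2.2, n3.1, n3.2,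
    _, l1, l2⟩

theorem sum_rowLen (lam : YoungDiagram) (N : ℕ) (hN : ∀ i, N ≤ i → lam.rowLen i = 0) :
    ∑ i ∈ range N, lam.rowLen i = lam.card := by
  rw [YoungDiagram.card, card_eq_sum_card_fiberwise (f := Prod.fst) (t := range N)]
  · apply sum_congr rfl
    intro i _
    rw [YoungDiagram.rowLen_eq_card]
    rfl
  · rintro ⟨i, j⟩ h
    have h' : (i, j) ∈ lam := h
    rw [YoungDiagram.mem_iff_lt_rowLen] at h'
    by_contra hc
    have := hN i (by simpa using hc)
    omega

theorem rowLen_pos_iff (lam : YoungDiagram) (i : ℕ) : 0 < lam.rowLen i ↔ i < lam.colLen 0 := by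
  rw [← YoungDiagram.mem_iff_lt_rowLen, YoungDiagram.mem_iff_lt_colLen]

theorem df_lt {N : ℕ} {u v : ℕ → ℕ} (j : ℕ) (hv : ∀ i, v i ≤ j) (hu : ∃ i < N, j < u i) :
    Df N u v := by
  obtain ⟨i, hi, h⟩ := hu
  refine ⟨j, ?_⟩
  have h1 := cnt_pos hi h
  have h2 : cnt N v j = 0 := by
    rw [cnt, Nat.count_eq_card_filter_range, card_eq_zero, filter_eq_empty_iff]
    intro k _
    have := hv k
    omega
  omega

theorem df_symm {N : ℕ} {u v : ℕ → ℕ} (h : Df N u v) : Df N v u := by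
  obtain ⟨j, hj⟩ := h
  exact ⟨j, fun h => hj h.symm⟩

theorem inter (N T : ℕ) (hi : ℕ → ℕ) (hhi : Antitone hi) (hT : T ≤ ∑ i ∈ range N, hi i) :
    ∀ (k : ℕ) (lo : ℕ → ℕ), Antitone lo → (∀ i, lo i ≤ hi i) → ∑ i ∈ range N, lo i + k = T →
    ∃ w : ℕ → ℕ, Antitone w ∧ (∀ i, lo i ≤ w i) ∧ (∀ i, w i ≤ hi i) ∧
      ∑ i ∈ range N, w i = T := by
  intro k
  induction k with
  | zero => intro lo h1 h2 h3; exact ⟨lo, h1, fun _ => le_rfl, h2, h3⟩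
  | succ k ih =>
    intro lo h1 h2 h3
    have hex : ∃ i, i < N ∧ lo i < hi i := by
      by_contra hc
      push Not at hc
      have : ∑ i ∈ range N, hi i ≤ ∑ i ∈ range N, lo i :=
        sum_le_sum (fun i hi => hc i (mem_range.1 hi))
      omega
    classical
    obtain ⟨hi1, hi2⟩ := Nat.find_spec hex
    have hmin : ∀ j < Nat.find hex, lo j = hi j := by
      intro j hj
      have := Nat.find_min hex hj
      have := h2 j
      by_contra hc
      exact Nat.find_min hex hj ⟨by omega, by omega⟩
    generalize Nat.find hex = i at hi1 hi2 hmin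
    obtain ⟨w, w1, w2, w3, w4⟩ := ih (fun j => lo j + if j = i then 1 else 0) (by
      intro a b hab
      have e1 := h1 hab
      dsimp only
      by_cases hb : b = i
      · subst hb
        by_cases ha : a = b
        · simp [ha]
        · have := hmin a (by omega)
          have := hhi hab
          simp only [ha, if_false, if_true]
          omega
      · simp only [hb, if_false]
        omega) (by
      intro j
      have := h2 j
      by_cases hj : j = i
      · subst hj; simp; omega
      · simp only [hj, if_false]; omega) (by
      rw [sum_add_distrib]
      simp only [sum_ite_eq', mem_range, hi1, if_true]
      omega)
    refine ⟨w, w1, fun j => ?_, w3, w4⟩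
    have := w2 j
    omega

/-- hook sequences -/
def hk (A a i : ℕ) : ℕ := if i = 0 then A else if i ≤ a then 1 else 0

theorem hk_zero (A a : ℕ) : hk A a 0 = A := rfl

theorem hk_le {A a i : ℕ} (h0 : i ≠ 0) : hk A a i ≤ 1 := by
  unfold hk; split_ifs <;> omega

theorem hk_one {A a i : ℕ} (h0 : i ≠ 0) (h : i ≤ a) : hk A a i = 1 := by
  unfold hk; rw [if_neg h0, if_pos h]

theorem hk_out {A a i : ℕ} (_h0 : i ≠ 0) (h : a < i) : hk A a i = 0 := by
  unfold hk; split_ifs <;> omega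

theorem sum_hk {A a N : ℕ} (h : a < N) : ∑ i ∈ range N, hk A a i = A + a := by
  obtain ⟨M, rfl⟩ : ∃ M, N = M + 1 := ⟨N - 1, by omega⟩
  rw [sum_range_succ', hk_zero]
  have : ∀ i ∈ range M, hk A a (i + 1) = if i < a then 1 else 0 := by
    intro i _
    unfold hk
    simp
  rw [sum_congr rfl this, ← card_filter]
  have h2 : (range M).filter (fun j => j < a) = range a := by
    ext v; simp only [mem_filter, mem_range]; omega
  rw [h2, card_range]; omega

theorem hk_anti {A a : ℕ} (h : 1 ≤ A) : Antitone (hk A a) := by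
  intro i j hij
  unfold hk
  split_ifs <;> omega

/-- three-row sequences -/
def s3 (a b c : ℕ) : ℕ → ℕ
  | 0 => a
  | 1 => b
  | 2 => c
  | _ + 3 => 0

theorem forall3 {P : ℕ → Prop} (h0 : P 0) (h1 : P 1) (h2 : P 2) (h3 : ∀ i, P (i + 3)) :
    ∀ i, P i
  | 0 => h0
  | 1 => h1
  | 2 => h2
  | i + 3 => h3 i

theorem s3_anti {a b c : ℕ} (h1 : b ≤ a) (h2 : c ≤ b) : Antitone (s3 a b c) := by
  apply antitone_nat_of_succ_le
  apply forall3
  · exact h1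
  · exact h2
  · exact Nat.zero_le _
  · intro i; exact Nat.zero_le _

theorem split3 {N : ℕ} (hN : 3 ≤ N) (g : ℕ → ℕ) :
    ∑ i ∈ range N, g i = g 0 + g 1 + g 2 + ∑ i ∈ range (N - 3), g (i + 3) := by
  obtain ⟨M, rfl⟩ : ∃ M, N = M + 3 := ⟨N - 3, by omega⟩
  rw [sum_range_succ', sum_range_succ', sum_range_succ']
  simp only [Nat.add_sub_cancel, zero_add, add_assoc, Nat.reduceAdd]
  omega

theorem sum_s3 {N a b c : ℕ} (hN : 3 ≤ N) : ∑ i ∈ range N, s3 a b c i = a + b + c := by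
  rw [split3 hN]
  simp [s3]

theorem pair_le {N i j : ℕ} (g : ℕ → ℕ) (hi : i < N) (hj : j < N) (hij : i ≠ j) :
    g i + g j ≤ ∑ k ∈ range N, g k := by
  rw [← add_sum_erase (range N) g (mem_range.2 hi)]
  have : g j ≤ ∑ k ∈ (range N).erase i, g k :=
    single_le_sum (f := g) (fun _ _ => Nat.zero_le _) (mem_erase.2 ⟨fun h => hij h.symm, mem_range.2 hj⟩)
  omega

/-- the standing assumptions -/
structure Par (m n N : ℕ) (f : ℕ → ℕ) : Prop where
  hm : 11 ≤ m
  anti : Antitone f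
  hN : n + 5 ≤ N
  zero : ∀ i, n ≤ i → f i = 0
  pos : ∀ i < n, 0 < f i
  sum : ∑ i ∈ range N, f i = 3 * m

theorem Par.four {m n N : ℕ} {f : ℕ → ℕ} (h : Par m n N f) :
    f 0 + f 1 + f 2 + f 3 ≤ 3 * m ∧ f 1 ≤ f 0 ∧ f 2 ≤ f 1 ∧ f 3 ≤ f 2 ∧ ∀ i, f (i + 3) ≤ f 3 := by
  have h1 := split3 (N := N) (by have := h.hN; omega) f
  have h2 : f (0 + 3) ≤ ∑ i ∈ range (N - 3), f (i + 3) :=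
    single_le_sum (f := fun i => f (i + 3)) (fun _ _ => Nat.zero_le _)
      (mem_range.2 (by have := h.hN; omega))
  have h3 := h.sum
  simp only [zero_add] at h2
  exact ⟨by omega, h.anti (by omega), h.anti (by omega), h.anti (by omega),
    fun i => h.anti (by omega)⟩

theorem good3 {m n N : ℕ} {f : ℕ → ℕ} (h : Par m n N f) (x0 x1 w0 w1 w2 : ℕ)
    (hx : x1 ≤ x0) (sx : x0 + x1 = m) (x02 : 2 ≤ x0) (x0m : x0 < m)
    (hw : w2 ≤ w1) (hw' : w1 ≤ w0) (sw : w0 + w1 + w2 = 2 * m) (l0 : x0 ≤ w0) (l1 : x1 ≤ w1)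
    (f0 : w0 ≤ f 0) (f1 : w1 ≤ f 1) (f2 : w2 ≤ f 2)
    (y0 : w0 - x0 < x0) (y1 : w1 - x1 < x0) (y2 : w2 < x0) (yb : 2 ≤ w0 - x0 ∨ 2 ≤ w1 - x1)
    (z0 : f 0 - w0 < x0) (z1 : f 1 - w1 < x0) (z2 : f 2 - w2 < x0) (z3 : f 3 < x0)
    (zb : 2 ≤ f 0 - w0 ∨ 2 ≤ f 1 - w1 ∨ 2 ≤ f 2 - w2 ∨ 2 ≤ f 3)
    (K : ℕ)
    (hd : (w0 - x0 ≤ K ∧ w1 - x1 ≤ K ∧ w2 ≤ K ∧ (K < f 0 - w0 ∨ K < f 1 - w1 ∨ K < f 2 - w2)) ∨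
      (f 0 - w0 ≤ K ∧ f 1 - w1 ≤ K ∧ f 2 - w2 ≤ K ∧ f 3 ≤ K ∧ (K < w0 - x0 ∨ K < w1 - x1))) :
    Good m N f := by
  have hN := h.hN
  obtain ⟨-, -, -, -, f3⟩ := h.four
  have ybd : ∀ i, s3 w0 w1 w2 i - s3 x0 x1 0 i ≤ x0 - 1 := by
    apply forall3 <;> (try intro i) <;> simp only [s3] <;> omega
  have zbd : ∀ i, f i - s3 w0 w1 w2 i ≤ x0 - 1 := by
    apply forall3 <;> (try intro i) <;> simp only [s3] <;> (try have := f3 i) <;> omega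
  refine ⟨s3 x0 x1 0, s3 w0 w1 w2, s3_anti hx (by omega), s3_anti hw' hw, ?_, ?_,
    by rw [sum_s3 (by omega)]; omega, by rw [sum_s3 (by omega)]; omega,
    ⟨⟨0, by omega, x02⟩, ?_⟩, ⟨?_, fun i => by have := ybd i; beta_reduce; omega⟩,
    ⟨?_, fun i => by have := zbd i; beta_reduce; omega⟩, df_lt (x0 - 1) ybd ⟨0, by omega, ?_⟩, ?_,
    df_lt (x0 - 1) zbd ⟨0, by omega, ?_⟩⟩
  · apply forall3 <;> (try intro i) <;> simp only [s3] <;> omega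
  · apply forall3 <;> (try intro i) <;> simp only [s3] <;> omega
  · apply forall3 <;> (try intro i) <;> simp only [s3] <;> omega
  · rcases yb with h | h
    · exact ⟨0, by omega, h⟩
    · exact ⟨1, by omega, h⟩
  · rcases zb with h | h | h | h
    · exact ⟨0, by omega, h⟩
    · exact ⟨1, by omega, h⟩
    · exact ⟨2, by omega, h⟩
    · exact ⟨3, by omega, h⟩
  · simp only [s3]; omega
  · rcases hd with ⟨a, b, c, d⟩ | ⟨a, b, c, d, e⟩
    · apply df_symm
      apply df_lt K
      · apply forall3 <;> (try intro i) <;> simp only [s3] <;> omega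
      · rcases d with h | h | h
        · exact ⟨0, by omega, h⟩
        · exact ⟨1, by omega, h⟩
        · exact ⟨2, by omega, h⟩
    · apply df_lt K
      · apply forall3 <;> (try intro i) <;> simp only [s3] <;> (try have := f3 i) <;> omega
      · rcases e with h | h
        · exact ⟨0, by omega, h⟩
        · exact ⟨1, by omega, h⟩
  · simp only [s3]; omega

theorem caseT {m n N : ℕ} {f : ℕ → ℕ} (h : Par m n N f) (h1 : m + 1 ≤ f 1)
    (h0 : f 0 ≤ 2 * m - 1) : Good m N f := by
  obtain ⟨a, b, c, d, -⟩ := h.four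
  have hm := h.hm
  by_cases e1 : f 0 = 2 * m - 1
  · apply good3 h (m - 2) 2 (m + 2) (m - 2) 0 (K := m - 4) <;> omega
  by_cases e2 : m - 2 ≤ f 2
  · apply good3 h (m - 1) 1 m (m - 1) 1 (K := m - 3) <;> omega
  · apply good3 h (m - 1) 1 (m + 1) (m - 1) 0 (K := m - 3) <;> omega

theorem caseM {m n N : ℕ} {f : ℕ → ℕ} (h : Par m n N f) (h1 : f 1 ≤ m)
    (h0 : m ≤ f 2) : Good m N f := by
  obtain ⟨a, b, c, d, -⟩ := h.four
  have hm := h.hm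
  apply good3 h (m - 1) 1 m (m - 3) 3 (K := m - 4) <;> omega

theorem caseS {m n N : ℕ} {f : ℕ → ℕ} (h : Par m n N f) (h1 : f 1 ≤ m) (hn : n ≤ 5)
    (h0 : 2 * m - 4 ≤ f 0) (h0' : f 0 ≤ 2 * m - 1) : Good m N f := by
  obtain ⟨a, b, c, d, e⟩ := h.four
  have hm := h.hm
  have hN := h.hN
  have hs : f 0 + f 1 + f 2 + f 3 + f 4 = 3 * m := by
    have h1 := split3 (N := N) (by omega) f
    have h2 := h.sum
    have h3 : ∑ i ∈ range (N - 3), f (i + 3) = f 3 + f 4 := by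
      obtain ⟨M, hM⟩ : ∃ M, N - 3 = M + 2 := ⟨N - 5, by omega⟩
      rw [hM, sum_range_succ', sum_range_succ', sum_eq_zero]
      · simp only [zero_add, Nat.reduceAdd]; omega
      · intro i _; exact h.zero _ (by omega)
    omega
  have e4 := e 1
  norm_num at e4
  by_cases e1 : 2 * m - 3 ≤ f 0
  · apply good3 h (m - 1) 1 (2 * m - 3) 3 0 (K := m - 3) <;> omega
  · apply good3 h (m - 1) 1 (2 * m - 4) 4 0 (K := m - 4) <;> omega

theorem caseI {m n N : ℕ} {f : ℕ → ℕ} (h : Par m n N f) (h0 : 2 * m ≤ f 0)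
    (h0' : f 0 ≤ 3 * m - 6) : Good m N f := by
  obtain ⟨a, b, c, d, e⟩ := h.four
  have hm := h.hm
  have hN := h.hN
  have hs := h.sum
  have hn : 2 ≤ n := by
    by_contra hc
    have h1 := split3 (N := N) (by omega) f
    rw [sum_eq_zero (fun i _ => h.zero (i + 3) (by omega)), h.zero 1 (by omega),
      h.zero 2 (by omega)] at h1
    omega
  have hf1 := h.pos 1 (by omega)
  have hhi : Antitone (fun i => if i = 0 then 2 * m - 3 else f i) := by
    intro i j hij
    dsimp only
    have := h.anti hij
    rcases Nat.eq_zero_or_pos j with hj | hj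
    · rw [if_pos hj, if_pos (by omega)]
    · rw [if_neg (show j ≠ 0 by omega)]
      have := h.anti (show 1 ≤ j from hj)
      split_ifs <;> omega
  have shi : f 0 + ∑ i ∈ range N, (if i = 0 then 2 * m - 3 else f i) = 3 * m + (2 * m - 3) := by
    rw [← hs]
    obtain ⟨M, rfl⟩ : ∃ M, N = M + 1 := ⟨N - 1, by omega⟩
    rw [sum_range_succ', sum_range_succ']
    simp
    omega
  obtain ⟨w, w1, w2, w3, w4⟩ := inter N (2 * m) _ hhi (by omega) 2 (s3 (2 * m - 3) 1 0)
    (s3_anti (by omega) (by omega))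
    (by apply forall3 <;> (try intro i) <;> simp [s3] <;> omega)
    (by rw [sum_s3 (by omega)]; omega)
  have w00 : w 0 = 2 * m - 3 := le_antisymm (by simpa using w3 0) (w2 0)
  have w11 : 1 ≤ w 1 := w2 1
  have w10 : ∀ i, i ≠ 0 → w i ≤ f i := fun i hi => by simpa [hi] using w3 i
  have wf : ∀ i, w i ≤ f i := fun i => by
    by_cases hi : i = 0
    · subst hi; omega
    · exact w10 i hi
  have ws : ∀ i, i ≠ 0 → w i ≤ 3 := fun i hi => by
    by_cases hiN : i < N
    · have := pair_le w (show 0 < N by omega) hiN (Ne.symm hi)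
      omega
    · have := wf i; have := h.zero i (by omega); omega
  have sz : ∑ i ∈ range N, (f i - w i) = m := by
    have := sum_sub N w f wf; omega
  have zs : ∀ i, f i - w i ≤ m - 3 := fun i => by
    by_cases hi : i = 0
    · subst hi; omega
    by_cases hiN : i < N
    · have := pair_le (fun i => f i - w i) (show 0 < N by omega) hiN (Ne.symm hi)
      omega
    · have := h.zero i (by omega); omega
  have ys : ∀ i, w i - s3 (m - 1) 1 0 i ≤ m - 2 := fun i => by
    by_cases hi : i = 0
    · subst hi; simp only [s3]; omega
    · have := ws i hi; omega
  refine ⟨s3 (m - 1) 1 0, w, s3_anti (by omega) (by omega), w1, ?_, wf,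
    by rw [sum_s3 (by omega)]; omega, w4, ⟨⟨0, by omega, by simp only [s3]; omega⟩, ?_⟩,
    ⟨⟨0, by omega, by simp only [s3]; omega⟩, fun i => by have := ys i; beta_reduce; omega⟩,
    ⟨⟨0, by omega, by beta_reduce; omega⟩, fun i => by have := zs i; beta_reduce; omega⟩,
    df_lt (m - 2) ys ⟨0, by omega, by simp only [s3]; omega⟩,
    df_lt (m - 3) zs ⟨0, by omega, by simp only [s3]; omega⟩,
    df_lt (m - 3) zs ⟨0, by omega, by simp only [s3]; omega⟩⟩
  · apply forall3 <;> (try intro i) <;> simp only [s3] <;> omega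
  · apply forall3 <;> (try intro i) <;> simp only [s3] <;> omega

theorem hook {m n N : ℕ} {f : ℕ → ℕ} (h : Par m n N f) (W q t : ℕ) (ht : t ≤ 1)
    (hW : W + q + t = 2 * m) (hs5 : 5 ≤ q + t) (hsm : q + t ≤ m + 2) (hqn : q < n)
    (hW0 : W ≤ f 0) (hW1 : 1 + t ≤ f 1)
    (hz : ∀ i, f i - (hk W q i + if i = 1 then t else 0) < m)
    (hz2 : ∃ i < N, 2 ≤ f i - (hk W q i + if i = 1 then t else 0)) : Good m N f := by
  have hm := h.hm
  have hN := h.hN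
  set w : ℕ → ℕ := fun i => hk W q i + if i = 1 then t else 0 with hw
  have w0 : w 0 = W := by simp [hw, hk_zero]
  have w1 : w 1 = 1 + t := by
    simp only [hw, if_true]; rw [hk_one (by omega) (by omega)]
  have w2 : ∀ i, 2 ≤ i → w i = hk W q i := fun i hi => by
    simp only [hw]; rw [if_neg (by omega)]; rfl
  have wa : Antitone w := by
    intro i j hij
    rcases Nat.eq_zero_or_pos i with hi | hi
    · subst hi
      rcases Nat.eq_zero_or_pos j with hj | hj
      · subst hj; exact le_rfl
      · have : w j ≤ 2 := by
          have := hk_le (A := W) (a := q) (i := j) (by omega)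
          simp only [hw]; split_ifs <;> omega
        omega
    · rcases Nat.lt_or_ge 1 i with hi' | hi'
      · rw [w2 i (by omega), w2 j (by omega)]; exact hk_anti (by omega) hij
      · have : i = 1 := by omega
        subst this
        rcases Nat.lt_or_ge 1 j with hj' | hj'
        · rw [w2 j (by omega)]
          have := hk_le (A := W) (a := q) (i := j) (by omega)
          omega
        · have : j = 1 := by omega
          subst this; exact le_rfl
  have wf : ∀ i, w i ≤ f i := by
    intro i
    by_cases hi0 : i = 0
    · subst hi0; omega
    by_cases hi1 : i = 1
    · subst hi1; omega
    rw [w2 i (by omega)]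
    by_cases hq : i ≤ q
    · have := h.pos i (by omega)
      have := hk_le (A := W) (a := q) (i := i) (by omega)
      omega
    · rw [hk_out (by omega) (by omega)]; omega
  have sw : ∑ i ∈ range N, w i = 2 * m := by
    simp only [hw]
    rw [sum_add_distrib, sum_hk (by omega)]
    simp only [sum_ite_eq', mem_range]
    rw [if_pos (by omega)]; omega
  obtain ⟨k, hkN, hkmax⟩ := exists_max_image (range N) (fun i => f i - w i) ⟨0, mem_range.2 (by omega)⟩
  set M := f k - w k with hM
  have zM : ∀ i, f i - w i ≤ M := fun i => by
    by_cases hi : i < N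
    · exact hkmax i (mem_range.2 hi)
    · have := h.zero i (by omega); omega
  have hkN' := mem_range.1 hkN
  obtain ⟨a, b, hab, a1, alb, hbm, hMa, hMb⟩ : ∃ a b, a + b = q + t ∧ 1 ≤ a ∧ a < b ∧ b + 2 ≤ m ∧
      M ≠ m - a ∧ M ≠ m - b := by
    by_cases c : M ≠ m - (q + t - 1) / 2 ∧ M ≠ m - (q + t - (q + t - 1) / 2)
    · exact ⟨(q + t - 1) / 2, q + t - (q + t - 1) / 2, by omega, by omega, by omega, by omega,
        c.1, c.2⟩
    · exact ⟨(q + t - 1) / 2 - 1, q + t - ((q + t - 1) / 2 - 1), by omega, by omega, by omega,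
        by omega, by omega, by omega⟩
  have ys : ∀ i, i ≠ 0 → w i - hk (m - a) a i ≤ 1 := fun i hi => by
    by_cases hi1 : i = 1
    · subst hi1; rw [hk_one (by omega) (by omega)]; omega
    · rw [w2 i (by omega)]
      have := hk_le (A := W) (a := q) (i := i) (by omega)
      omega
  have y0 : w 0 - hk (m - a) a 0 = m - b := by rw [hk_zero]; omega
  have ym : ∀ i, w i - hk (m - a) a i ≤ m - b := fun i => by
    by_cases hi : i = 0
    · subst hi; omega
    · have := ys i hi; omega
  have xm : ∀ i, hk (m - a) a i ≤ m - a := fun i => by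
    by_cases hi : i = 0
    · subst hi; rw [hk_zero]
    · have := hk_le (A := m - a) (a := a) hi; omega
  refine ⟨hk (m - a) a, w, hk_anti (by omega), wa, ?_, wf, by rw [sum_hk (by omega)]; omega, sw,
    ⟨⟨0, by omega, by rw [hk_zero]; omega⟩, fun i => by have := xm i; omega⟩,
    ⟨⟨0, by omega, by beta_reduce; rw [y0]; omega⟩, fun i => by have := ym i; beta_reduce; omega⟩, ⟨hz2, hz⟩,
    df_lt (m - b) ym ⟨0, by omega, by rw [hk_zero]; omega⟩, ?_, ?_⟩
  · intro i
    by_cases hi : i = 0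
    · subst hi; rw [hk_zero]; omega
    by_cases hia : i ≤ a
    · rw [hk_one hi hia]
      simp only [hw]
      rw [hk_one hi (by omega)]; omega
    · rw [hk_out hi (by omega)]; omega
  · rcases Nat.lt_or_gt_of_ne hMb with c | c
    · exact df_lt M zM ⟨0, by omega, by beta_reduce; rw [y0]; exact c⟩
    · exact df_symm (df_lt (m - b) ym ⟨k, hkN', c⟩)
  · rcases Nat.lt_or_gt_of_ne hMa with c | c
    · exact df_lt M zM ⟨0, by omega, by rw [hk_zero]; exact c⟩
    · exact df_symm (df_lt (m - a) xm ⟨k, hkN', c⟩)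

theorem two_of_sum {m l N : ℕ} {u : ℕ → ℕ} (hl : l < N) (h0 : ∀ i, l ≤ i → u i = 0)
    (hs : l < m) (hm : ∑ i ∈ range N, u i = m) : ∃ i < N, 2 ≤ u i := by
  by_contra hc
  push Not at hc
  have : ∑ i ∈ range N, u i ≤ ∑ i ∈ range N, hk 1 (l - 1) i := by
    apply sum_le_sum
    intro i hi
    have h1 := hc i (mem_range.1 hi)
    by_cases hi0 : i = 0
    · subst hi0; rw [hk_zero]; omega
    · by_cases hil : l ≤ i
      · rw [h0 i hil]; omega
      · rw [hk_one hi0 (by omega)]; omega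
  rw [sum_hk (by omega), hm] at this
  rcases Nat.eq_zero_or_pos l with h | h
  · subst h
    rw [sum_eq_zero (fun i _ => h0 i (by omega))] at hm
    omega
  · omega

theorem coreU {m n N : ℕ} {f : ℕ → ℕ} (h : Par m n N f) (p : ℕ) (x : ℕ → ℕ) (hx : Antitone x)
    (hx0 : x 0 = p) (sx : ∑ i ∈ range N, x i = m) (xf : ∀ i, x i ≤ f i)
    (hfx : ∀ i, i ≠ 0 → f i - x i ≤ p) (hpm : p < m) (hp2 : 2 ≤ p) (hu : p + 1 ≤ f 0)
    (hu' : f 0 + 1 ≤ 2 * p) (hn0 : 1 ≤ n) (hnu : n + f 0 ≤ m + 1 + p) (hnm : n < m) :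
    Good m N f := by
  have hN := h.hN
  have hs := h.sum
  have x0 : ∀ i, n ≤ i → x i = 0 := fun i hi => by have := xf i; have := h.zero i hi; omega
  set lo : ℕ → ℕ := fun i => if i = 0 then f 0 else min (f i) (x i + 1) with hlo
  set hi : ℕ → ℕ := fun i => if i = 0 then f 0 else min (f i) (x i + p - 1) with hhi
  have lo_a : Antitone lo := by
    intro i j hij
    have e1 := h.anti hij
    have e2 := hx hij
    have e3 := h.anti (Nat.zero_le j)
    simp only [hlo]
    split_ifs <;> omega
  have hi_a : Antitone hi := by
    intro i j hij
    have e1 := h.anti hij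
    have e2 := hx hij
    have e3 := h.anti (Nat.zero_le j)
    simp only [hhi]
    split_ifs <;> omega
  have lh : ∀ i, lo i ≤ hi i := by
    intro i
    simp only [hlo, hhi]
    split_ifs <;> omega
  have slo : ∑ i ∈ range N, lo i ≤ 2 * m := by
    have : ∑ i ∈ range N, lo i ≤ ∑ i ∈ range N, (x i + hk (f 0 - p) (n - 1) i) := by
      apply sum_le_sum
      intro i _
      simp only [hlo]
      by_cases hi0 : i = 0
      · subst hi0; rw [hk_zero]; simp only [if_true]; omega
      · rw [if_neg hi0]
        by_cases hin : n ≤ i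
        · have := h.zero i hin; omega
        · rw [hk_one hi0 (by omega)]; omega
    rw [sum_add_distrib, sum_hk (by omega), sx] at this
    omega
  have shi : 2 * m ≤ ∑ i ∈ range N, hi i := by
    have : ∑ i ∈ range N, f i ≤ ∑ i ∈ range N, (hi i + hk 0 (n - 1) i) := by
      apply sum_le_sum
      intro i _
      simp only [hhi]
      by_cases hi0 : i = 0
      · subst hi0; rw [hk_zero]; simp
      · rw [if_neg hi0]
        by_cases hin : n ≤ i
        · have := h.zero i hin; omega
        · rw [hk_one hi0 (by omega)]
          have := hfx i hi0
          omega
    rw [sum_add_distrib, sum_hk (by omega), hs] at this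
    omega
  obtain ⟨w, w1, w2, w3, w4⟩ := inter N (2 * m) hi hi_a shi (2 * m - ∑ i ∈ range N, lo i) lo
    lo_a lh (by omega)
  have w00 : w 0 = f 0 := by
    have e1 := w2 0
    have e2 := w3 0
    simp only [hlo, hhi, if_true] at e1 e2
    omega
  have wl : ∀ i, i ≠ 0 → min (f i) (x i + 1) ≤ w i := fun i hi0 => by
    have e1 := w2 i
    simp only [hlo] at e1
    rwa [if_neg hi0] at e1
  have wh : ∀ i, i ≠ 0 → w i ≤ min (f i) (x i + p - 1) := fun i hi0 => by
    have e1 := w3 i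
    simp only [hhi] at e1
    rwa [if_neg hi0] at e1
  have wf : ∀ i, w i ≤ f i := fun i => by
    by_cases hi0 : i = 0
    · subst hi0; omega
    · have := wh i hi0; omega
  have xw : ∀ i, x i ≤ w i := fun i => by
    by_cases hi0 : i = 0
    · subst hi0; omega
    · have := wl i hi0; have := xf i; omega
  have yb : ∀ i, w i - x i ≤ p - 1 := fun i => by
    by_cases hi0 : i = 0
    · subst hi0; omega
    · have := wh i hi0; omega
  have zb : ∀ i, f i - w i ≤ p - 1 := fun i => by
    by_cases hi0 : i = 0
    · subst hi0; omega
    · have := wl i hi0; have := hfx i hi0; omega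
  have sy : ∑ i ∈ range N, (w i - x i) = m := by have := sum_sub N x w xw; omega
  have sz : ∑ i ∈ range N, (f i - w i) = m := by have := sum_sub N w f wf; omega
  refine ⟨x, w, hx, w1, xw, wf, sx, w4, ⟨⟨0, by omega, by omega⟩, fun i => ?_⟩,
    ⟨two_of_sum (l := n) (by omega) (fun i hi => ?_) hnm sy, fun i => ?_⟩,
    ⟨two_of_sum (l := n) (by omega) (fun i hi => ?_) hnm sz, fun i => ?_⟩,
    df_lt (p - 1) yb ⟨0, by omega, by omega⟩, ⟨0, ?_⟩, df_lt (p - 1) zb ⟨0, by omega, by omega⟩⟩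
  · have := hx (Nat.zero_le i); omega
  · have := wf i; have := h.zero i hi; beta_reduce; omega
  · have := yb i; beta_reduce; omega
  · have := h.zero i hi; beta_reduce; omega
  · have := zb i; beta_reduce; omega
  · rw [cnt, cnt, Nat.count_eq_card_filter_range, Nat.count_eq_card_filter_range]
    apply ne_of_gt
    apply card_lt_card
    rw [ssubset_iff_of_subset]
    · refine ⟨0, ?_, ?_⟩
      · simp only [mem_filter, mem_range]; omega
      · simp only [mem_filter, mem_range]; omega
    · intro i hi
      simp only [mem_filter, mem_range] at hi ⊢
      refine ⟨hi.1, ?_⟩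
      by_cases hi0 : i = 0
      · subst hi0; omega
      · have := wl i hi0; omega

theorem caseUB {m n N : ℕ} {f : ℕ → ℕ} (h : Par m n N f) (h0 : m ≤ f 0) (h1 : f 1 ≤ m)
    (h2 : f 2 ≤ m - 1) (hs : f 0 + n ≤ 2 * m) (h0' : f 0 ≤ 2 * m - 1) (hn : n < m) :
    Good m N f := by
  obtain ⟨a, b, c, d, e⟩ := h.four
  have hm := h.hm
  have hN := h.hN
  have hn3 : 3 ≤ n := by
    by_contra hc
    have h1 := split3 (N := N) (by omega) f
    have := h.sum
    rw [sum_eq_zero (fun i _ => h.zero (i + 3) (by omega)), h.zero 2 (by omega)] at h1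
    omega
  have p1 := h.pos 1 (by omega)
  apply coreU h (m - 1) (s3 (m - 1) 1 0) (s3_anti (by omega) (by omega)) rfl
    (by rw [sum_s3 (by omega)]; omega) <;> try omega
  · apply forall3 <;> (try intro i) <;> simp only [s3] <;> omega
  · apply forall3 <;> (try intro i) <;> simp only [s3] <;> (try have := e i) <;> omega

theorem caseUA {m n N : ℕ} {f : ℕ → ℕ} (h : Par m n N f) (h0 : f 0 ≤ m - 1) (hn : n ≤ f 0) :
    Good m N f := by
  have hm := h.hm
  have hN := h.hN
  have hs := h.sum
  have hn0 : 1 ≤ n := by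
    by_contra hc
    rw [sum_eq_zero (fun i _ => h.zero i (by omega))] at hs
    omega
  have f6 : 6 ≤ f 0 := by
    by_contra hc
    have h1 : ∑ i ∈ range N, f i ≤ ∑ i ∈ range N, f 0 * hk 1 (n - 1) i := by
      apply sum_le_sum
      intro i _
      by_cases hi0 : i = 0
      · subst hi0; rw [hk_zero]; omega
      · by_cases hin : n ≤ i
        · have := h.zero i hin; omega
        · rw [hk_one hi0 (by omega), mul_one]; exact h.anti (Nat.zero_le i)
    rw [← mul_sum, sum_hk (by omega), hs] at h1
    have : f 0 * (1 + (n - 1)) ≤ 5 * 5 := Nat.mul_le_mul (by omega) (by omega)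
    omega
  set g : ℕ → ℕ := fun i => f i - (f 0 - 1) with hg
  have hgi : ∀ i, g i = f i - (f 0 - 1) := fun i => rfl
  have g1 : ∀ i, g i ≤ 1 := fun i => by
    have := h.anti (Nat.zero_le i); simp only [hg]; omega
  set r := ∑ i ∈ range N, g i with hr
  have r1 : r ≤ n := by
    have : r ≤ ∑ i ∈ range N, hk 1 (n - 1) i := by
      apply sum_le_sum
      intro i _
      by_cases hi0 : i = 0
      · subst hi0; rw [hk_zero]; exact g1 0
      · by_cases hin : n ≤ i
        · have := h.zero i hin; simp only [hg]; omega
        · rw [hk_one hi0 (by omega)]; exact g1 i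
    rw [sum_hk (by omega)] at this
    omega
  have r2 : r * f 0 ≤ 3 * m := by
    rw [hr, sum_mul, ← hs]
    apply sum_le_sum
    intro i _
    have e1 := g1 i
    have e2 : g i = f i - (f 0 - 1) := rfl
    rcases Nat.eq_zero_or_pos (g i) with e | e
    · rw [e]; omega
    · have e3 : g i = 1 := by omega
      rw [e3]; omega
  have r3 : f 0 + r ≤ m + 2 := by
    rcases Nat.lt_or_ge r 4 with hr4 | hr4
    · omega
    · obtain ⟨a, ha⟩ : ∃ a, f 0 = a + 4 := ⟨f 0 - 4, by omega⟩
      obtain ⟨b, hb⟩ : ∃ b, r = b + 4 := ⟨r - 4, by omega⟩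
      rw [ha, hb] at r2
      have : (b + 4) * (a + 4) = b * a + 4 * a + 4 * b + 16 := by ring
      have : 0 ≤ b * a := Nat.zero_le _
      omega
  obtain ⟨x, x1, x2, x3, x4⟩ := inter N m (fun i => min (f i) (f 0 - 1)) (by
      intro i j hij
      have := h.anti hij
      dsimp only
      omega) (by
      have : ∑ i ∈ range N, f i ≤ ∑ i ∈ range N, (min (f i) (f 0 - 1) + hk 1 (n - 1) i) := by
        apply sum_le_sum
        intro i _
        have := h.anti (Nat.zero_le i)
        by_cases hi0 : i = 0
        · subst hi0; rw [hk_zero]; omega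
        · by_cases hin : n ≤ i
          · have := h.zero i hin; omega
          · rw [hk_one hi0 (by omega)]; omega
      rw [sum_add_distrib, sum_hk (by omega), hs] at this
      omega) (m - (f 0 - 2 + r)) (fun i => g i + if i = 0 then f 0 - 2 else 0) (by
      intro i j hij
      have := h.anti hij
      have := hgi i
      have := hgi j
      dsimp only
      split_ifs <;> omega) (by
      intro i
      have := h.anti (Nat.zero_le i)
      have := hgi i
      by_cases hi0 : i = 0
      · subst hi0; simp only [if_true]; omega
      · rw [if_neg hi0]; omega) (by
      rw [sum_add_distrib]
      simp only [sum_ite_eq', mem_range]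
      rw [if_pos (by omega)]
      omega)
  have x00 : x 0 = f 0 - 1 := by
    have e1 := x2 0
    have e2 := x3 0
    simp only [hg, if_true] at e1 e2
    omega
  apply coreU h (f 0 - 1) x x1 x00 x4 <;> try omega
  · intro i; have := x3 i; omega
  · intro i hi
    have := x2 i
    simp only [hg, if_neg hi] at this
    omega

theorem caseH {m n N : ℕ} {f : ℕ → ℕ} (h : Par m n N f) (h0 : m ≤ f 0) (h0' : f 0 ≤ 2 * m - 1)
    (h1 : f 1 ≤ m) (h2 : f 2 ≤ m - 1) (hn : 6 ≤ n) (hnf : n ≤ f 0) (hs : 2 * m + 1 ≤ f 0 + n ∨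
      (f 0 = m ∧ n = m)) : Good m N f := by
  obtain ⟨a, b, c, d, e⟩ := h.four
  have hm := h.hm
  have hN := h.hN
  have hsum := h.sum
  have p1 := h.pos 1 (by omega)
  by_cases hE : f 0 = m ∧ n = m
  · obtain ⟨e1, e2⟩ := hE
    have hf1 : 2 ≤ f 1 := by
      by_contra hc
      have : ∑ i ∈ range N, f i ≤ ∑ i ∈ range N, hk m (n - 1) i := by
        apply sum_le_sum
        intro i _
        by_cases hi0 : i = 0
        · subst hi0; rw [hk_zero]; omega
        · by_cases hin : n ≤ i
          · have := h.zero i hin; omega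
          · rw [hk_one hi0 (by omega)]
            have := h.anti (show 1 ≤ i by omega); omega
      rw [sum_hk (by omega)] at this
      omega
    apply hook h m (m - 1) 1 <;> try omega
    · intro i
      by_cases hi0 : i = 0
      · subst hi0; rw [hk_zero]; omega
      · have := h.anti (show 1 ≤ i by omega)
        by_cases hin : n ≤ i
        · have := h.zero i hin; omega
        · rw [hk_one hi0 (by omega)]; omega
    · by_contra hc
      push Not at hc
      have : ∑ i ∈ range N, f i ≤ ∑ i ∈ range N, ((hk m (m - 1) i + if i = 1 then 1 else 0)
          + hk 0 (m - 1) i) := by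
        apply sum_le_sum
        intro i hi
        have e3 := hc i (mem_range.1 hi)
        by_cases hi0 : i = 0
        · subst hi0; rw [hk_zero, hk_zero]; omega
        · by_cases hin : n ≤ i
          · have := h.zero i hin; omega
          · rw [hk_one (A := 0) hi0 (by omega)]; omega
      rw [sum_add_distrib, sum_add_distrib, sum_hk (by omega), sum_hk (by omega)] at this
      simp only [sum_ite_eq', mem_range] at this
      rw [if_pos (by omega)] at this
      omega
  have hs' : 2 * m + 1 ≤ f 0 + n := by omega
  by_cases hH : 2 * m + 3 ≤ f 0 + n
  · obtain ⟨s, hs1, hs2, hs3, hs4, hs5⟩ : ∃ s, 5 ≤ s ∧ s ≤ m + 2 ∧ s < n ∧ 2 * m + 2 ≤ f 0 + s ∧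
        f 0 + s ≤ 2 * m + 4 := by
      by_cases c : f 0 + 5 ≤ 2 * m + 2
      · exact ⟨2 * m + 2 - f 0, by omega⟩
      · exact ⟨5, by omega⟩
    apply hook h (2 * m - s) s 0 <;> try omega
    · intro i
      by_cases hi0 : i = 0
      · subst hi0; rw [hk_zero]; omega
      · by_cases hi1 : i = 1
        · subst hi1; rw [hk_one hi0 (by omega)]; omega
        · have := h.anti (show 2 ≤ i by omega); omega
    · refine ⟨0, by omega, ?_⟩
      rw [hk_zero, if_neg (by omega)]; omega
  by_cases hf1 : 3 ≤ f 1
  · apply hook h (2 * m - (n - 1)) (n - 1) 0 <;> try omega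
    · intro i
      by_cases hi0 : i = 0
      · subst hi0; rw [hk_zero]; omega
      · by_cases hi1 : i = 1
        · subst hi1; rw [hk_one hi0 (by omega)]; omega
        · have := h.anti (show 2 ≤ i by omega); omega
    · refine ⟨1, by omega, ?_⟩
      rw [hk_one (by omega) (by omega), if_pos rfl]; omega
  have fle : ∀ i, i ≠ 0 → f i ≤ 2 := fun i hi => by
    have := h.anti (show 1 ≤ i by omega); omega
  have k1 : 3 * m ≤ f 0 + (n - 1) + (n - 1) := by
    have : ∑ i ∈ range N, f i ≤ ∑ i ∈ range N, (hk (f 0) (n - 1) i + hk 0 (n - 1) i) := by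
      apply sum_le_sum
      intro i _
      by_cases hi0 : i = 0
      · subst hi0; rw [hk_zero]; omega
      · by_cases hin : n ≤ i
        · have := h.zero i hin; omega
        · rw [hk_one hi0 (by omega), hk_one hi0 (by omega)]
          exact fle i hi0
    rw [sum_add_distrib, sum_hk (by omega), sum_hk (by omega)] at this
    omega
  have k2 : 2 ≤ f (m - 1) := by
    by_contra hc
    have : ∑ i ∈ range N, f i ≤ ∑ i ∈ range N, (hk (f 0) (n - 1) i + hk 0 (m - 2) i) := by
      apply sum_le_sum
      intro i _
      by_cases hi0 : i = 0
      · subst hi0; rw [hk_zero]; omega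
      · by_cases hin : n ≤ i
        · have := h.zero i hin; omega
        · rw [hk_one hi0 (by omega)]
          by_cases him : i ≤ m - 2
          · rw [hk_one hi0 (by omega)]
            exact fle i hi0
          · have := h.anti (show m - 1 ≤ i by omega); omega
    rw [sum_add_distrib, sum_hk (by omega), sum_hk (by omega)] at this
    omega
  have k3 := h.anti (show 1 ≤ m - 1 by omega)
  apply hook h (m + 1) (m - 2) 1 <;> try omega
  · intro i
    by_cases hi0 : i = 0
    · subst hi0; rw [hk_zero]; omega
    · have := fle i hi0; omega
  · refine ⟨m - 1, by omega, ?_⟩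
    rw [hk_out (by omega) (by omega), if_neg (by omega)]; omega

theorem good_all {m n N : ℕ} {f : ℕ → ℕ} (h : Par m n N f) (h0 : f 0 ≤ 3 * m - 6)
    (hc : 2 * m ≤ f 0 ∨ n ≤ f 0) : Good m N f := by
  have hm := h.hm
  by_cases c1 : 2 * m ≤ f 0
  · exact caseI h c1 h0
  by_cases c2 : m + 1 ≤ f 1
  · exact caseT h c2 (by omega)
  by_cases c3 : f 0 ≤ m - 1
  · exact caseUA h c3 (by omega)
  by_cases c4 : m ≤ f 2
  · exact caseM h (by omega) c4
  by_cases c5 : n ≤ 5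
  · by_cases c6 : 2 * m - 4 ≤ f 0
    · exact caseS h (by omega) c5 c6 (by omega)
    · exact caseUB h (by omega) (by omega) (by omega) (by omega) (by omega) (by omega)
  by_cases c7 : 2 * m + 1 ≤ f 0 + n ∨ (f 0 = m ∧ n = m)
  · exact caseH h (by omega) (by omega) (by omega) (by omega) (by omega) (by omega) c7
  · exact caseUB h (by omega) (by omega) (by omega) (by omega) (by omega) (by omega)

theorem par_row {m : ℕ} (hm : 11 ≤ m) (lam : YoungDiagram) (hcard : lam.card = 3 * m) :
    Par m (lam.colLen 0) (lam.colLen 0 + 5) lam.rowLen := by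
  have hz : ∀ i, lam.colLen 0 ≤ i → lam.rowLen i = 0 := fun i hi => by
    have := rowLen_pos_iff lam i; omega
  refine ⟨hm, fun i j hij => lam.rowLen_anti i j hij, le_rfl, hz,
    fun i hi => (rowLen_pos_iff lam i).2 hi, ?_⟩
  rw [sum_rowLen lam _ (fun i hi => hz i (by omega)), hcard]

theorem main {m : ℕ} (hm : 11 ≤ m) (lam : YoungDiagram) (hcard : lam.card = 3 * m)
    (h1 : lam.rowLen 0 ≤ 3 * m - 6) (h2 : lam.colLen 0 ≤ 3 * m - 6) : Concl m lam := by
  by_cases hc : 2 * m ≤ lam.rowLen 0 ∨ (lam.colLen 0 < 2 * m ∧ lam.colLen 0 ≤ lam.rowLen 0)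
  · have hp := par_row hm lam hcard
    exact concl_row (fun i hi => hp.zero i (by omega)) hp.sum (good_all hp h1 (by omega))
  · have hp := par_row hm lam.transpose (by rw [tr_card, hcard])
    have e : lam.transpose.rowLen = lam.colLen := funext fun i => by
      rw [YoungDiagram.rowLen_transpose]
    rw [e] at hp
    rw [YoungDiagram.colLen_transpose] at hp
    exact concl_col (fun i hi => hp.zero i (by omega)) hp.sum (good_all hp h2 (by omega))

end LRaux

/-- Let `m ≥ 11` and let `λ` be a partition of `3m` with `λ_1 ≤ 3m − 6`
and `λ'_1 ≤ 3m − 6`.  Then there exist pairwise distinct partitions `α, β, γ` of `m`, none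
equal to `(m)` or `(1^m)`, such that the coefficient of `s_λ` in `s_α s_β s_γ`, i.e. the
iterated Littlewood–Richardson number `∑_η c^η_{αβ} c^λ_{ηγ}`, is positive. -/
theorem exists_three_distinct_LR (m : ℕ) (hm : 11 ≤ m) (lam : YoungDiagram)
    (hcard : lam.card = 3 * m) (h1 : lam.rowLen 0 ≤ 3 * m - 6)
    (h2 : lam.colLen 0 ≤ 3 * m - 6) :
    ∃ alp bet gam : YoungDiagram,
      alp.card = m ∧ bet.card = m ∧ gam.card = m ∧
      alp ≠ bet ∧ bet ≠ gam ∧ alp ≠ gam ∧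
      alp.rowLens ≠ [m] ∧ alp.rowLens ≠ List.replicate m 1 ∧
      bet.rowLens ≠ [m] ∧ bet.rowLens ≠ List.replicate m 1 ∧
      gam.rowLens ≠ [m] ∧ gam.rowLens ≠ List.replicate m 1 ∧
      ∃ eta : YoungDiagram, 0 < lrCoeff alp bet eta ∧ 0 < lrCoeff eta gam lam := by
  exact LRaux.main hm lam hcard h1 h2
end
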